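/- arXiv:2204.06303 — 5 statements merged into one kernel-verified Lean document; each statement's English description precedes it below -/
import Mathlib

section
/- Let A be a commutative ring, S ⊆ A a multiplicative subset, and r ≥ 2 a natural number. If every unimodular row (a₀(t), …, a_r(t)) over A[t] with (a₀(0), …, a_r(0)) = (1, 0, …, 0) is completable, then every unimodular row (b₀(t), …, b_r(t)) over the localization A_S[t] with (b₀(0), …, b_r(0)) = (1, 0, …, 0) is completable. -/
open Polynomial

/-- Unimodular row: the entries generate the unit ideal. -/
def IsUnimodular {A : Type} [CommRing A] {n : ℕ} (v : Fin n → A) : Prop :=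
  Ideal.span (Set.range v) = ⊤

/-- A row is completable if it occurs as a row of an invertible square matrix. -/
def IsCompletable {A : Type} [CommRing A] {n : ℕ} (v : Fin n → A) : Prop :=
  ∃ M : Matrix (Fin n) (Fin n) A, IsUnit M ∧ ∃ i, M i = v


lemma isUnimodular_iff {A : Type} [CommRing A] {n : ℕ} (v : Fin n → A) :
    IsUnimodular v ↔ ∃ c : Fin n → A, ∑ i, c i * v i = 1 := by
  unfold IsUnimodular
  rw [Ideal.eq_top_iff_one, Ideal.mem_span_range_iff_exists_fun]

/-- The scaling endomorphism `t ↦ s t`. -/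
noncomputable def scal {A : Type} [CommRing A] (s : A) : Polynomial A →+* Polynomial A :=
  Polynomial.compRingHom (C s * X)

lemma scal_apply {A : Type} [CommRing A] (s : A) (p : Polynomial A) :
    scal s p = p.comp (C s * X) := rfl

lemma scal_scal {A : Type} [CommRing A] (s u : A) (p : Polynomial A) :
    scal s (scal u p) = scal (s * u) p := by
  ext n
  simp only [scal_apply, comp_C_mul_X_coeff]
  ring

lemma scal_one {A : Type} [CommRing A] (p : Polynomial A) :
    scal 1 p = p := by
  simp [scal_apply]

lemma scal_coeff_zero {A : Type} [CommRing A] (s : A) (p : Polynomial A) :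
    (scal s p).coeff 0 = p.coeff 0 := by
  simp only [scal_apply, comp_C_mul_X_coeff]
  ring

lemma scal_map {A B : Type} [CommRing A] [CommRing B] (f : A →+* B) (s : A) (p : Polynomial A) :
    (scal s p).map f = scal (f s) (p.map f) := by
  simp [scal_apply, Polynomial.map_comp]

lemma scal_mul_X {A : Type} [CommRing A] (s : A) (q : Polynomial A) :
    scal s (q * X) = scal s (C s * q) * X := by
  simp [scal_apply]
  ring

lemma scal_C {A : Type} [CommRing A] (s a : A) : scal s (C a) = C a := by
  simp [scal_apply]

lemma exists_lift {A : Type} [CommRing A] (S : Submonoid A) (f : Polynomial (Localization S))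
    (e : A) (he : f.coeff 0 = algebraMap A (Localization S) e) :
    ∃ s ∈ S, ∃ g : Polynomial A, g.coeff 0 = e ∧
      g.map (algebraMap A (Localization S)) = scal (algebraMap A (Localization S) s) f := by
  obtain ⟨b, hb, hN⟩ := IsLocalization.integerNormalization_spec S f.divX
  refine ⟨b, hb, scal b (IsLocalization.integerNormalization S f.divX) * X + C e, by simp, ?_⟩
  have hN' : (IsLocalization.integerNormalization S f.divX).map (algebraMap A (Localization S)) =
      C (algebraMap A (Localization S) b) * f.divX := by
    rw [hN, ← algebraMap_smul (Localization S) b f.divX, smul_eq_C_mul]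
  conv_rhs => rw [← divX_mul_X_add f]
  rw [map_add, scal_mul_X, scal_C, he, Polynomial.map_add, Polynomial.map_mul, scal_map, hN',
    map_X, map_C]

lemma exists_lift_family {A : Type} [CommRing A] (S : Submonoid A) {ι : Type} [Fintype ι]
    (f : ι → Polynomial (Localization S)) (e : ι → A)
    (he : ∀ i, (f i).coeff 0 = algebraMap A (Localization S) (e i)) :
    ∃ s ∈ S, ∃ g : ι → Polynomial A, ∀ i, (g i).coeff 0 = e i ∧
      (g i).map (algebraMap A (Localization S)) =
        scal (algebraMap A (Localization S) s) (f i) := by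
  classical
  choose s hs g hg0 hg using fun i => exists_lift S (f i) (e i) (he i)
  refine ⟨∏ i, s i, S.prod_mem fun i _ => hs i,
    fun i => scal (∏ j ∈ Finset.univ.erase i, s j) (g i), fun i => ⟨?_, ?_⟩⟩
  · rw [scal_coeff_zero, hg0]
  · rw [scal_map, hg, scal_scal, ← map_mul, Finset.prod_erase_mul _ _ (Finset.mem_univ i)]

lemma exists_kill {A : Type} [CommRing A] (S : Submonoid A) (p : Polynomial A)
    (h0 : p.coeff 0 = 0) (hp : p.map (algebraMap A (Localization S)) = 0) :
    ∃ s ∈ S, scal s p = 0 := by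
  have hX : p.divX * X = p := by
    have := divX_mul_X_add p
    rwa [h0, C_0, add_zero] at this
  have hq : p.divX.map (algebraMap A (Localization S)) = 0 := by
    ext n
    have := congrArg (fun q => q.coeff (n+1)) hp
    simpa [coeff_divX] using this
  let _ := Polynomial.algebra A (Localization S)
  have := Polynomial.isLocalization S (Localization S)
  have hq' : algebraMap (Polynomial A) (Polynomial (Localization S)) p.divX = 0 := hq
  rw [IsLocalization.map_eq_zero_iff (S.map (C : A →+* Polynomial A))] at hq'
  obtain ⟨⟨_, s, hs, rfl⟩, hm⟩ := hq'
  refine ⟨s, hs, ?_⟩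
  rw [← hX, scal_mul_X]
  have hm' : C s * p.divX = 0 := hm
  rw [hm', map_zero, zero_mul]

lemma IsCompletable.map {A B : Type} [CommRing A] [CommRing B] (f : A →+* B) {n : ℕ}
    {v : Fin n → A} (h : IsCompletable v) : IsCompletable (fun i => f (v i)) := by
  obtain ⟨M, hM, i, rfl⟩ := h
  exact ⟨f.mapMatrix M, hM.map f.mapMatrix, i, rfl⟩

lemma exists_dual {B : Type} [CommRing B] {r : ℕ} (b : Fin (r + 1) → Polynomial B)
    (hb : IsUnimodular b) (h0 : ∀ i, (b i).coeff 0 = if i = 0 then 1 else 0) :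
    ∃ c : Fin (r + 1) → Polynomial B, ∑ i, c i * b i = 1 ∧
      ∀ i, (c i).coeff 0 = if i = 0 then 1 else 0 := by
  obtain ⟨c, hc⟩ := (isUnimodular_iff b).1 hb
  have hc0 : (c 0).coeff 0 = 1 := by
    have := congrArg (fun q => q.coeff 0) hc
    simpa [mul_coeff_zero, h0] using this
  have hb0 : ∀ i : Fin r, (b i.succ).coeff 0 = 0 := fun i => by simp [h0]
  refine ⟨Fin.cons (c 0 + ∑ i : Fin r, C ((c i.succ).coeff 0) * b i.succ)
    (fun i => c i.succ - C ((c i.succ).coeff 0) * b 0), ?_, ?_⟩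
  · rw [Fin.sum_univ_succ] at hc ⊢
    simp only [Fin.cons_zero, Fin.cons_succ, sub_mul, Finset.sum_sub_distrib, add_mul,
      Finset.sum_mul]
    rw [← hc]
    have : ∑ i : Fin r, C ((c i.succ).coeff 0) * b i.succ * b 0
        = ∑ i : Fin r, C ((c i.succ).coeff 0) * b 0 * b i.succ :=
      Finset.sum_congr rfl fun i _ => by ring
    rw [this]; ring
  · intro i
    refine Fin.cases ?_ (fun i => ?_) i
    · simp [mul_coeff_zero, hb0, hc0]
    · simp [mul_coeff_zero, h0]

/-- **Proposition (Roitman-type localization).** Let `A` be a commutative ring, `S ⊆ A` a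
multiplicative subset, `r ≥ 2`.  If every unimodular row over `A[t]` which equals
`(1, 0, …, 0)` at `t = 0` is completable, then every unimodular row over `A_S[t]` which
equals `(1, 0, …, 0)` at `t = 0` is completable. -/
theorem completable_of_localization (A : Type) [CommRing A] (S : Submonoid A)
    (r : ℕ) (hr : 2 ≤ r)
    (h : ∀ a : Fin (r + 1) → Polynomial A, IsUnimodular a →
      (∀ i, (a i).eval 0 = if i = 0 then 1 else 0) → IsCompletable a) :
    ∀ b : Fin (r + 1) → Polynomial (Localization S), IsUnimodular b →
      (∀ i, (b i).eval 0 = if i = 0 then 1 else 0) → IsCompletable b := by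
  intro b hb hb0
  simp only [← coeff_zero_eq_eval_zero] at h hb0
  obtain ⟨c, hc, hc0⟩ := exists_dual b hb hb0
  obtain ⟨s, hs, a, ha⟩ := exists_lift_family S b (fun i => if i = 0 then 1 else 0)
    (fun i => by rw [hb0]; split_ifs <;> simp)
  obtain ⟨u, hu, d, hd⟩ := exists_lift_family S c (fun i => if i = 0 then 1 else 0)
    (fun i => by rw [hc0]; split_ifs <;> simp)
  obtain ⟨w, hw, hk⟩ := exists_kill S (∑ i, scal s (d i) * scal u (a i) - 1)
    (by simp [mul_coeff_zero, scal_coeff_zero, ha, hd])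
    (by
      simp only [Polynomial.map_sub, Polynomial.map_sum, Polynomial.map_mul, scal_map, ha, hd,
        scal_scal, Polynomial.map_one]
      rw [mul_comm (algebraMap A (Localization S) u)]
      simp only [← map_mul, ← map_sum]
      rw [hc, map_one, sub_self])
  have key := h (fun i => scal w (scal u (a i)))
    ((isUnimodular_iff _).2 ⟨fun i => scal w (scal s (d i)), by
      rw [map_sub, map_one, sub_eq_zero] at hk
      simpa only [map_sum, map_mul] using hk⟩)
    (fun i => by rw [scal_coeff_zero, scal_coeff_zero, (ha i).1])
  have key2 := key.map (Polynomial.mapRingHom (algebraMap A (Localization S)))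
  obtain ⟨z, hz⟩ := (IsLocalization.map_units (Localization S)
    (⟨w * u * s, S.mul_mem (S.mul_mem hw hu) hs⟩ : S)).exists_left_inv
  have key3 := key2.map (scal z)
  convert key3 using 2 with i
  simp only [coe_mapRingHom, scal_map, (ha i).2, scal_scal]
  simp only [map_mul, ← mul_assoc] at hz ⊢
  rw [hz, scal_one]
end

section
/- Let R be a commutative ring and r ≥ 2 a natural number. Then the following are equivalent: (i) for every commutative local R-algebra A, every unimodular row of length r+1 over A[t] is completable; (ii) for every commutative R-algebra A, every unimodular row (a₀(t), …, a_r(t)) over A[t] with (a₀(0), …, a_r(0)) = (1, 0, …, 0) is completable. -/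
open Polynomial

namespace QP
open Matrix

variable {A : Type} [CommRing A] {L : Type} [CommRing L]

/-- `p(x) ↦ p(x + s y)`. -/
noncomputable def sub2 (s : A) : A[X] →+* A[X][X] :=
  eval₂RingHom (C.comp C) (C X + C (C s) * X)

/-- `p(x,y) ↦ p(x, s y)`. -/
noncomputable def T (s : A) : A[X][X] →+* A[X][X] :=
  eval₂RingHom C (C (C s) * X)

/-- `p(x,y) ↦ p(x + s y, y)`. -/
noncomputable def U (s : A) : A[X][X] →+* A[X][X] :=
  eval₂RingHom (sub2 s) X

/-- base change -/
noncomputable def Ph (f : A →+* L) : A[X][X] →+* L[X][X] :=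
  mapRingHom (mapRingHom f)

lemma T_C (s : A) (p : A[X]) : T s (C p) = C p := by simp [T]
lemma T_X (s : A) : T s X = C (C s) * X := by simp [T]
lemma U_C (s : A) (p : A[X]) : U s (C p) = sub2 s p := by simp [U]
lemma sub2_C (s : A) (a : A) : sub2 s (C a) = C (C a) := by simp [sub2]
lemma sub2_X (s : A) : sub2 s X = C X + C (C s) * X := by simp [sub2]

lemma T_sub2 (a s : A) (p : A[X]) : T a (sub2 s p) = sub2 (s * a) p := by
  have : (T a).comp (sub2 s) = sub2 (s * a) := by
    apply Polynomial.ringHom_ext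
    · intro c; simp [sub2_C, T_C]
    · simp [sub2_X, T_C, T_X, mul_assoc]
  exact RingHom.congr_fun this p

lemma T_T (a s : A) (p : A[X][X]) : T a (T s p) = T (s * a) p := by
  have : (T a).comp (T s) = T (s * a) := by
    apply Polynomial.ringHom_ext
    · intro c; simp [T_C]
    · simp [T_C, T_X, mul_assoc]
  exact RingHom.congr_fun this p

lemma U_sub2 (s s' : A) (p : A[X]) : U s (sub2 s' p) = sub2 (s + s') p := by
  have : (U s).comp (sub2 s') = sub2 (s + s') := by
    apply Polynomial.ringHom_ext
    · intro c; simp [sub2_C, U_C]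
    · simp only [RingHom.comp_apply, sub2_X, map_add, map_mul, U_C, sub2_C]
      simp [U, add_mul, add_assoc]
  exact RingHom.congr_fun this p

lemma Ph_C (f : A →+* L) (p : A[X]) : Ph f (C p) = C (p.map f) := by simp [Ph]

lemma Ph_T (f : A →+* L) (s : A) (p : A[X][X]) : Ph f (T s p) = T (f s) (Ph f p) := by
  have : (Ph f).comp (T s) = (T (f s)).comp (Ph f) := by
    apply Polynomial.ringHom_ext
    · intro c; simp [T_C, Ph_C]
    · simp [T_X, Ph]
  exact RingHom.congr_fun this p

lemma Ph_sub2 (f : A →+* L) (s : A) (p : A[X]) :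
    Ph f (sub2 s p) = sub2 (f s) (p.map f) := by
  have : (Ph f).comp (sub2 s) = (sub2 (f s)).comp (mapRingHom f) := by
    apply Polynomial.ringHom_ext
    · intro c; simp [sub2_C, Ph_C]
    · simp [sub2_X, Ph]
  exact RingHom.congr_fun this p

lemma eval_T (s : A) (p : A[X][X]) : (T s p).eval 0 = p.eval 0 := by
  have : (evalRingHom 0).comp (T s) = evalRingHom 0 := by
    apply Polynomial.ringHom_ext
    · intro c; simp [T_C]
    · simp [T_X]
  exact RingHom.congr_fun this p

lemma eval_sub2 (s : A) (p : A[X]) : (sub2 s p).eval 0 = p := by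
  have : (evalRingHom 0).comp (sub2 s) = RingHom.id A[X] := by
    apply Polynomial.ringHom_ext
    · intro c; simp [sub2_C]
    · simp [sub2_X]
  exact RingHom.congr_fun this p

section loc
variable (M : Submonoid A) [Algebra A L] [IsLocalization M L]

lemma exists_lift {ι : Type} [Finite ι] (p : ι → L[X][X]) (c : ι → A[X])
    (hc : ∀ i, (p i).eval 0 = (c i).map (algebraMap A L)) :
    ∃ s ∈ M, ∃ q : ι → A[X][X], ∀ i,
      Ph (algebraMap A L) (q i) = T (algebraMap A L s) (p i) ∧ (q i).eval 0 = c i := by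
  have key : ∃ s ∈ M, ∀ i, ∃ q : A[X][X],
      Ph (algebraMap A L) q = C (C (algebraMap A L s)) * (p i).divX := by
    let _ : Algebra A[X] L[X] := (mapRingHom (algebraMap A L)).toAlgebra
    let _ : Algebra A[X][X] L[X][X] := (Ph (algebraMap A L)).toAlgebra
    have h1 : IsLocalization (M.map (C : A →+* A[X])) L[X] :=
      Polynomial.isLocalization M L
    have h2 : IsLocalization ((M.map (C : A →+* A[X])).map (C : A[X] →+* A[X][X])) L[X][X] :=
      Polynomial.isLocalization _ L[X]
    obtain ⟨⟨b, b1, ⟨s, hs, rfl⟩, rfl⟩, hb⟩ := IsLocalization.exist_integer_multiples_of_finite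
      ((M.map (C : A →+* A[X])).map (C : A[X] →+* A[X][X])) (fun i => (p i).divX)
    refine ⟨s, hs, fun i => ?_⟩
    obtain ⟨q, hq⟩ := hb i
    refine ⟨q, ?_⟩
    have : Ph (algebraMap A L) q = Ph (algebraMap A L) (C (C s)) * (p i).divX := hq
    rw [this, Ph_C]; simp
  obtain ⟨s, hs, h⟩ := key
  choose q hq using h
  refine ⟨s, hs, fun i => C (c i) + X * T s (q i), fun i => ⟨?_, by simp⟩⟩
  rw [map_add, map_mul, Ph_C, Ph_T, hq]
  conv_rhs => rw [← Polynomial.divX_mul_X_add (p i), coeff_zero_eq_eval_zero, hc]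
  simp only [map_add, map_mul, T_C, T_X]
  simp only [Ph, coe_mapRingHom, map_X]
  ring

lemma exists_kill {ι : Type} [Finite ι] (p q : ι → A[X][X])
    (hc : ∀ i, (p i).eval 0 = (q i).eval 0)
    (h : ∀ i, Ph (algebraMap A L) (p i) = Ph (algebraMap A L) (q i)) :
    ∃ s ∈ M, ∀ i, T s (p i) = T s (q i) := by
  have key : ∀ i, ∃ s ∈ M, C (C s) * (p i).divX = C (C s) * (q i).divX := by
    intro i
    let _ : Algebra A[X] L[X] := (mapRingHom (algebraMap A L)).toAlgebra
    let _ : Algebra A[X][X] L[X][X] := (Ph (algebraMap A L)).toAlgebra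
    have h1 : IsLocalization (M.map (C : A →+* A[X])) L[X] :=
      Polynomial.isLocalization M L
    have h2 : IsLocalization ((M.map (C : A →+* A[X])).map (C : A[X] →+* A[X][X])) L[X][X] :=
      Polynomial.isLocalization _ L[X]
    have h3 : algebraMap A[X][X] L[X][X] (p i).divX = algebraMap A[X][X] L[X][X] (q i).divX := by
      change (p i).divX.map _ = (q i).divX.map _
      ext1 n
      simp only [coeff_map, coeff_divX]
      have := congrArg (fun z => coeff z (n+1)) (h i)
      simpa only [Ph, coe_mapRingHom, coeff_map] using this
    obtain ⟨⟨b, b1, ⟨s, hs, rfl⟩, rfl⟩, hb⟩ := IsLocalization.exists_of_eq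
      (M := (M.map (C : A →+* A[X])).map (C : A[X] →+* A[X][X])) h3
    exact ⟨s, hs, hb⟩
  choose s hs h using key
  have := Fintype.ofFinite ι
  refine ⟨∏ i, s i, prod_mem fun i _ => hs i, fun i => ?_⟩
  obtain ⟨a, ha⟩ : s i ∣ ∏ i, s i := Finset.dvd_prod_of_mem s (Finset.mem_univ i)
  rw [ha]
  have h4 : C (C (s i * a)) * (p i).divX = C (C (s i * a)) * (q i).divX := by
    rw [mul_comm (s i) a, map_mul, map_mul, mul_assoc, h i, mul_assoc]
  have h5 := congrArg (T (s i * a)) h4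
  rw [← Polynomial.divX_mul_X_add (p i), ← Polynomial.divX_mul_X_add (q i),
    coeff_zero_eq_eval_zero, coeff_zero_eq_eval_zero, hc]
  simp only [map_add, map_mul, T_C, T_X] at h5 ⊢
  linear_combination X * h5

end loc

/-- the Quillen ideal predicate -/
def Q {n : ℕ} (v : Fin n → A[X]) (s : A) : Prop :=
  ∃ G : Matrix (Fin n) (Fin n) A[X][X], IsUnit G ∧
    (fun i => sub2 s (v i)) = (fun i => C (v i)) ᵥ* G

lemma map_row {B D : Type} [CommRing B] [CommRing D] {n : ℕ} (f : B →+* D) (u w : Fin n → B)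
    (G : Matrix (Fin n) (Fin n) B) (h : u = w ᵥ* G) :
    (fun i => f (u i)) = (fun i => f (w i)) ᵥ* (f.mapMatrix G) := by
  subst h
  funext i
  exact RingHom.map_vecMul f G w i

lemma Q_ideal {n : ℕ} (v : Fin n → A[X]) : ∃ I : Ideal A, ∀ s, s ∈ I ↔ Q v s := by
  refine ⟨{ carrier := {s | Q v s}, add_mem' := ?_, zero_mem' := ?_, smul_mem' := ?_ },
    fun s => Iff.rfl⟩
  · rintro s s' ⟨G, hG, h⟩ ⟨G', hG', h'⟩
    refine ⟨G * (U s).mapMatrix G', hG.mul (hG'.map _), ?_⟩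
    have := map_row (U s) _ _ _ h'
    simp only [U_sub2, U_C] at this
    rw [this, h, vecMul_vecMul]
  · refine ⟨1, isUnit_one, ?_⟩
    rw [vecMul_one]
    funext i
    have : sub2 (0 : A) = C := by
      apply Polynomial.ringHom_ext
      · intro c; simp [sub2_C]
      · simp [sub2_X]
    rw [this]
  · rintro a s ⟨G, hG, h⟩
    refine ⟨(T a).mapMatrix G, hG.map _, ?_⟩
    have := map_row (T a) _ _ _ h
    simp only [T_sub2, T_C] at this
    rw [smul_eq_mul, mul_comm, this]

lemma Q_local (M : Submonoid A) [Algebra A L] [IsLocalization M L] {n : ℕ} (v : Fin n → A[X])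
    (h : IsCompletable (fun i => (v i).map (algebraMap A L))) : ∃ s ∈ M, Q v s := by
  obtain ⟨H, ⟨⟨H', K, hHK, hKH⟩, rfl⟩, i, hi⟩ := h
  simp only at hi
  set G : Matrix (Fin n) (Fin n) L[X][X] :=
    (C : L[X] →+* _).mapMatrix K * (sub2 (1 : L)).mapMatrix H' with hG
  set G' : Matrix (Fin n) (Fin n) L[X][X] :=
    (sub2 (1 : L)).mapMatrix K * (C : L[X] →+* _).mapMatrix H' with hG'
  have hGG' : G * G' = 1 := by
    rw [hG, hG', mul_assoc, ← mul_assoc ((sub2 (1 : L)).mapMatrix H'), ← map_mul, hHK, map_one,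
      one_mul, ← map_mul, hKH, map_one]
  have hG0 : (evalRingHom (0 : L[X])).mapMatrix G = 1 := by
    have e1 : (evalRingHom (0 : L[X])).mapMatrix ((C : L[X] →+* _).mapMatrix K) = K := by
      ext1 a b; simp
    have e2 : (evalRingHom (0 : L[X])).mapMatrix ((sub2 (1 : L)).mapMatrix H') = H' := by
      ext1 a b; simp [eval_sub2]
    rw [hG, map_mul, e1, e2, hKH]
  have hG'0 : (evalRingHom (0 : L[X])).mapMatrix G' = 1 := by
    have e1 : (evalRingHom (0 : L[X])).mapMatrix ((C : L[X] →+* _).mapMatrix H') = H' := by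
      ext1 a b; simp
    have e2 : (evalRingHom (0 : L[X])).mapMatrix ((sub2 (1 : L)).mapMatrix K) = K := by
      ext1 a b; simp [eval_sub2]
    rw [hG', map_mul, e1, e2, hKH]
  have hrow : (fun j => sub2 (1 : L) ((v j).map (algebraMap A L))) =
      (fun j => C ((v j).map (algebraMap A L))) ᵥ* G := by
    have hw : (fun j => (v j).map (algebraMap A L)) = Pi.single i 1 ᵥ* H' := by
      rw [single_one_vecMul]; exact hi.symm
    have hw' : Pi.single i 1 = (fun j => (v j).map (algebraMap A L)) ᵥ* K := by
      rw [hw, vecMul_vecMul, hHK, vecMul_one]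
    have a1 := map_row (sub2 (1 : L)) _ _ _ hw
    have a2 := map_row (C : L[X] →+* L[X][X]) _ _ _ hw'
    have e : ∀ f : L[X] →+* L[X][X], (fun j => f ((Pi.single i 1 : Fin n → L[X]) j))
        = Pi.single i 1 := by
      intro f; funext j
      by_cases hj : j = i
      · subst hj; simp
      · simp [hj]
    rw [e] at a1 a2
    rw [hG, ← vecMul_vecMul, ← a2]
    exact a1
  obtain ⟨s, hs, q, hq⟩ := exists_lift M
    (fun x : Bool × Fin n × Fin n => (if x.1 then G else G') x.2.1 x.2.2)
    (fun x => (1 : Matrix (Fin n) (Fin n) A[X]) x.2.1 x.2.2) (by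
      rintro ⟨b, j, k⟩
      have hone : ((1 : Matrix (Fin n) (Fin n) A[X]) j k).map (algebraMap A L)
          = (1 : Matrix (Fin n) (Fin n) L[X]) j k := by
        by_cases hjk : j = k
        · subst hjk; simp
        · simp [hjk]
      rw [hone]
      cases b
      · exact congrFun (congrFun hG'0 j) k
      · exact congrFun (congrFun hG0 j) k)
  set P : Matrix (Fin n) (Fin n) A[X][X] := fun j k => q (true, j, k) with hP
  set P' : Matrix (Fin n) (Fin n) A[X][X] := fun j k => q (false, j, k) with hP'
  set ph := Ph (algebraMap A L) with hph
  have hP1 : ph.mapMatrix P = (T (algebraMap A L s)).mapMatrix G := by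
    ext1 j k; exact (hq (true, j, k)).1
  have hP1' : ph.mapMatrix P' = (T (algebraMap A L s)).mapMatrix G' := by
    ext1 j k; exact (hq (false, j, k)).1
  have hP0 : (evalRingHom (0 : A[X])).mapMatrix P = 1 := by
    ext1 j k; exact (hq (true, j, k)).2
  have hP0' : (evalRingHom (0 : A[X])).mapMatrix P' = 1 := by
    ext1 j k; exact (hq (false, j, k)).2
  obtain ⟨t, ht, hk⟩ := exists_kill (L := L) M
    (fun x : Fin n × Fin n => (P * P') x.1 x.2) (fun x => (1 : Matrix _ _ A[X][X]) x.1 x.2)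
    (by
      rintro ⟨j, k⟩
      have : (evalRingHom (0 : A[X])).mapMatrix (P * P')
          = (evalRingHom (0 : A[X])).mapMatrix 1 := by
        rw [map_mul, hP0, hP0', map_one, one_mul]
      exact congrFun (congrFun this j) k)
    (by
      rintro ⟨j, k⟩
      have : ph.mapMatrix (P * P') = ph.mapMatrix 1 := by
        rw [map_mul, hP1, hP1', ← map_mul, hGG', map_one, map_one]
      exact congrFun (congrFun this j) k)
  obtain ⟨t', ht', hk'⟩ := exists_kill (L := L) M
    (fun j => sub2 s (v j)) ((fun j => C (v j)) ᵥ* P)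
    (by
      intro j
      have := congrFun (map_row (evalRingHom (0 : A[X])) _ (fun j => C (v j)) P rfl) j
      rw [hP0, vecMul_one] at this
      rw [eval_sub2]
      simpa using this.symm)
    (by
      intro j
      have a1 := congrFun (map_row ph _ (fun j => C (v j)) P rfl) j
      have a2 := congrFun (map_row (T (algebraMap A L s)) _ _ _ hrow) j
      simp only [T_sub2, one_mul, T_C] at a2
      rw [hP1] at a1
      simp only [hph, Ph_C] at a1
      rw [Ph_sub2, a2, a1])
  refine ⟨s * (t * t'), M.mul_mem hs (M.mul_mem ht ht'), (T (t * t')).mapMatrix P, ?_, ?_⟩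
  · have e1 : (T t).mapMatrix P * (T t).mapMatrix P' = 1 := by
      rw [← map_mul, ← map_one ((T t).mapMatrix)]
      ext1 j k; exact hk (j, k)
    have e2 : IsUnit ((T t).mapMatrix P) :=
      (Matrix.isUnit_iff_isUnit_det _).2 (Matrix.isUnit_det_of_right_inverse e1)
    have e3 := e2.map (T t').mapMatrix
    convert e3 using 1
    ext1 j k
    simp only [RingHom.mapMatrix_apply, Matrix.map_apply]
    rw [T_T]
  · have a1 : (fun j => T t' (sub2 s (v j))) = _ := funext hk'
    have a2 := map_row (T t') _ (fun j => C (v j)) P rfl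
    rw [a2] at a1
    have a3 := map_row (T t) _ _ _ a1
    simp only [T_sub2, T_C] at a3
    rw [mul_comm t t', ← mul_assoc, a3]
    congr 1
    ext1 j k
    simp only [RingHom.mapMatrix_apply, Matrix.map_apply]
    rw [T_T, mul_comm]

lemma row_span {B : Type} [CommRing B] {n : ℕ} (u w : Fin n → B)
    (G : Matrix (Fin n) (Fin n) B) (h : u = w ᵥ* G) (hu : IsUnimodular u) : IsUnimodular w := by
  unfold IsUnimodular at *
  rw [eq_top_iff, ← hu, Ideal.span_le]
  rintro _ ⟨i, rfl⟩
  rw [h]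
  change ∑ j, w j * G j i ∈ Ideal.span (Set.range w)
  refine Ideal.sum_mem _ fun j _ => Ideal.mul_mem_right _ _ (Ideal.subset_span (Set.mem_range_self j))

end QP

open Matrix QP

theorem local_completable_iff_pointed_completable (R : Type) [CommRing R]
    (r : ℕ) (hr : 2 ≤ r) :
    (∀ (A : Type) [CommRing A] [IsLocalRing A] [Algebra R A],
      ∀ v : Fin (r + 1) → Polynomial A, IsUnimodular v → IsCompletable v) ↔
    (∀ (A : Type) [CommRing A] [Algebra R A],
      ∀ v : Fin (r + 1) → Polynomial A, IsUnimodular v →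
        (∀ i, (v i).eval 0 = if i = 0 then 1 else 0) → IsCompletable v) := by
  constructor
  · intro H A _ _ v hv h0
    obtain ⟨I, hI⟩ := Q_ideal v
    have hItop : I = ⊤ := by
      by_contra hne
      obtain ⟨m, hm, hIm⟩ := Ideal.exists_le_maximal I hne
      have := hm.isPrime
      have hc := H (Localization.AtPrime m)
        (fun i => (v i).map (algebraMap A (Localization.AtPrime m))) (by
          unfold IsUnimodular at *
          have := congrArg (Ideal.map (mapRingHom (algebraMap A (Localization.AtPrime m)))) hv
          rw [Ideal.map_span, Ideal.map_top, ← Set.range_comp] at this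
          exact this)
      obtain ⟨s, hs, hQ⟩ := Q_local m.primeCompl v hc
      exact hs (hIm ((hI s).2 hQ))
    obtain ⟨G, hG, h⟩ := (hI 1).1 (hItop ▸ Submodule.mem_top)
    refine ⟨(mapRingHom (evalRingHom (0 : A))).mapMatrix G, hG.map _, 0, ?_⟩
    have a := map_row (mapRingHom (evalRingHom (0 : A))) _ _ _ h
    have e1 : ∀ p : A[X], mapRingHom (evalRingHom (0 : A)) (sub2 1 p) = p := by
      intro p
      have : (mapRingHom (evalRingHom (0 : A))).comp (sub2 1) = RingHom.id _ := by
        apply Polynomial.ringHom_ext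
        · intro c; simp [sub2_C]
        · simp [sub2_X]
      exact RingHom.congr_fun this p
    have e2 : (fun i => mapRingHom (evalRingHom (0 : A)) (C (v i))) = Pi.single 0 1 := by
      funext i
      simp only [coe_mapRingHom, map_C, coe_evalRingHom, h0]
      by_cases hi : i = 0
      · subst hi; simp
      · simp [hi]
    rw [e2, single_one_vecMul] at a
    simp only [e1] at a
    exact a.symm
  · intro H A _ _ _ v hv
    have hunit : ∃ k, IsUnit ((v k).eval 0) := by
      by_contra! hcon
      have : Ideal.map (evalRingHom (0 : A)) (Ideal.span (Set.range v)) = ⊤ := by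
        rw [show Ideal.span (Set.range v) = ⊤ from hv, Ideal.map_top]
      rw [Ideal.map_span, ← Set.range_comp] at this
      have hle : Ideal.span (Set.range (evalRingHom (0 : A) ∘ v)) ≤
          IsLocalRing.maximalIdeal A := by
        rw [Ideal.span_le]
        rintro _ ⟨k, rfl⟩
        exact (IsLocalRing.mem_maximalIdeal _).2 (hcon k)
      rw [this, top_le_iff] at hle
      exact (IsLocalRing.maximalIdeal.isMaximal A).ne_top hle
    obtain ⟨k, hk⟩ := hunit
    set M0 : Matrix (Fin (r+1)) (Fin (r+1)) A :=
      (1 : Matrix _ _ A).updateRow k (fun i => (v i).eval 0) with hM0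
    have hM0u : IsUnit M0 := by
      rw [Matrix.isUnit_iff_isUnit_det, hM0, ← Matrix.cramer_transpose_apply, transpose_one,
        Matrix.cramer_one]
      exact hk
    have hMu : IsUnit (M0.submatrix (Equiv.swap 0 k) (Equiv.refl _)) :=
      (Matrix.isUnit_submatrix_equiv _ _).2 hM0u
    obtain ⟨⟨M, K, hMK, hKM⟩, hM⟩ := hMu
    simp only at hM
    have hrow : (fun i => (v i).eval 0) = Pi.single 0 1 ᵥ* M := by
      rw [single_one_vecMul]
      funext i
      rw [hM, hM0]
      simp [Matrix.row]
    have hCKM : (C : A →+* A[X]).mapMatrix K * (C : A →+* A[X]).mapMatrix M = 1 := by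
      rw [← map_mul, hKM, map_one]
    have hv' : v = (v ᵥ* (C : A →+* A[X]).mapMatrix K) ᵥ* (C : A →+* A[X]).mapMatrix M := by
      rw [vecMul_vecMul, hCKM, vecMul_one]
    obtain ⟨N, hN, i, hi⟩ := H A (v ᵥ* (C : A →+* A[X]).mapMatrix K) (row_span _ _ _ hv' hv) (by
      intro i
      have a := congrFun (map_row (evalRingHom (0 : A)) _ v ((C : A →+* A[X]).mapMatrix K) rfl) i
      have e : (evalRingHom (0 : A)).mapMatrix ((C : A →+* A[X]).mapMatrix K) = K := by
        ext1 a b; simp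
      simp only [e, coe_evalRingHom] at a
      rw [a, hrow, vecMul_vecMul, hMK, vecMul_one]
      by_cases hi : i = 0
      · subst hi; simp
      · simp [hi])
    refine ⟨N * (C : A →+* A[X]).mapMatrix M, hN.mul ?_, i, ?_⟩
    · exact IsUnit.map _ ⟨⟨M, K, hMK, hKM⟩, rfl⟩
    · rw [hv', ← hi]
      funext j
      rfl
end

section
/- Let R be a commutative ring and r ≥ 2 a natural number. Suppose that for all k, n ∈ ℕ, every unimodular row (a₀(t), …, a_r(t)) over B^R_{r,k,n}[t] with (a₀(0), …, a_r(0)) = (1, 0, …, 0) is completable. Then for every commutative local R-algebra A, every unimodular row of length r+1 over A[t] is completable. -/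
open Polynomial

/-- The set `S_{r,n}` of variables `x_{i,j}` (left summand) and `y_{i,j}` (right summand),
for `0 ≤ i ≤ r` and `0 ≤ j ≤ n`. -/
abbrev FinVars (r n : ℕ) : Type := (Fin (r + 1) × Fin (n + 1)) ⊕ (Fin (r + 1) × Fin (n + 1))

/-- The polynomial `p_ℓ = Σ_{i=0}^r Σ_{j=0}^ℓ x_{i,j} y_{i,ℓ-j}` in `R[S_{r,n}]`. -/
noncomputable def pFin (R : Type) [CommRing R] (r n : ℕ) (ℓ : Fin (n + 1)) :
    MvPolynomial (FinVars r n) R :=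
  ∑ i : Fin (r + 1), ∑ j : Fin (ℓ.1 + 1),
    MvPolynomial.X (Sum.inl (i, ⟨j.1, by have := j.isLt; have := ℓ.isLt; omega⟩)) *
    MvPolynomial.X (Sum.inr (i, ⟨ℓ.1 - j.1, by have := ℓ.isLt; omega⟩))

/-- The ideal of `R[S_{r,n}]` generated by the `p_ℓ` with `0 ≤ ℓ ≤ n`, `ℓ ≠ k`. -/
noncomputable def JFin (R : Type) [CommRing R] (r k n : ℕ) :
    Ideal (MvPolynomial (FinVars r n) R) :=
  Ideal.span {q | ∃ ℓ : Fin (n + 1), (ℓ : ℕ) ≠ k ∧ q = pFin R r n ℓ}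

/-- The ring `B^R_{r,k,n} = R[S_{r,n}]/(p₀, …, p̂_k, …, p_n)`. -/
def BFin (R : Type) [CommRing R] (r k n : ℕ) : Type :=
  MvPolynomial (FinVars r n) R ⧸ JFin R r k n

noncomputable instance (R : Type) [CommRing R] (r k n : ℕ) : CommRing (BFin R r k n) :=
  inferInstanceAs (CommRing (MvPolynomial (FinVars r n) R ⧸ JFin R r k n))


lemma completable_of_mul {A : Type} [CommRing A] {n : ℕ} {v : Fin n → A}
    {M : Matrix (Fin n) (Fin n) A} (hM : IsUnit M) (h : IsCompletable (Matrix.vecMul v M)) :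
    IsCompletable v := by
  obtain ⟨u, rfl⟩ := hM
  obtain ⟨N, hN, i, hi⟩ := h
  refine ⟨N * (↑u⁻¹ : Matrix (Fin n) (Fin n) A), hN.mul u⁻¹.isUnit, i, ?_⟩
  rw [Matrix.mul_apply_eq_vecMul, hi, Matrix.vecMul_vecMul]
  simp

lemma completable_map {A B : Type} [CommRing A] [CommRing B] {n : ℕ} {v : Fin n → A}
    (f : A →+* B) (h : IsCompletable v) : IsCompletable (fun i => f (v i)) := by
  obtain ⟨N, hN, i, hi⟩ := h
  refine ⟨N.map f, ?_, i, ?_⟩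
  · exact hN.map f.mapMatrix
  · ext j; simp [hi]

lemma unimodular_iff {A : Type} [CommRing A] {n : ℕ} (v : Fin n → A) :
    IsUnimodular v ↔ ∃ w : Fin n → A, ∑ i, v i * w i = 1 := by
  unfold IsUnimodular
  rw [Ideal.eq_top_iff_one, Ideal.mem_span_range_iff_exists_fun]
  simp only [mul_comm]

/-- The Cayley-Hamilton step: an element outside `p` killing the power `X ^ k`. -/
lemma exists_annihilator_aux {B M : Type} [CommRing B] [CommRing M] [Algebra B M]
    [Module.Finite B M] (mk : B[X] →ₐ[B] M) (hsurj : Function.Surjective mk)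
    (p : Ideal B) [p.IsPrime] (k N : ℕ) (s : B) (hs : s ∉ p) (g : B[X])
    (h0 : mk (X ^ k * (C s + X * g)) = 0) (q : B[X]) (hq : q ∈ p.map (C : B →+* B[X]))
    (h2 : mk (X ^ N) = mk q) : ∃ f : B, f ∉ p ∧ mk (C f * X ^ k) = 0 := by
  classical
  let U : Submodule B M := LinearMap.range (LinearMap.mulLeft B (mk (X ^ k)))
  have hUfg : Module.Finite B U := Module.Finite.range _
  have key : ∀ u ∈ U, (s ^ N) • u ∈ p • U := by
    rintro _ ⟨m, rfl⟩
    obtain ⟨m, rfl⟩ := hsurj m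
    change (s ^ N) • (mk (X ^ k) * mk m) ∈ p • U
    have h1 : ∀ j, mk (X ^ k) * mk (C s) ^ j = mk (X ^ k) * mk (- (X * g)) ^ j := by
      intro j
      induction j with
      | zero => simp
      | succ j ih =>
        have e : mk (X ^ k) * mk (C s) = mk (X ^ k) * mk (-(X * g)) := by
          rw [← sub_eq_zero, ← h0]; simp only [map_mul, map_add, map_neg, map_pow]; ring
        rw [pow_succ, ← mul_assoc, ih, mul_right_comm, e]; ring
    have h3 : (s ^ N) • (mk (X ^ k) * mk m) = mk (X ^ k) * mk (q * ((- g) ^ N * m)) := by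
      have : (s ^ N) • (mk (X ^ k) * mk m) = mk (X ^ k) * mk (C s) ^ N * mk m := by
        rw [Algebra.smul_def, map_pow]
        have : algebraMap B M s = mk (C s) := (mk.commutes s).symm
        rw [this]; ring
      rw [this, h1, ← mul_neg]
      have e2 : mk (X * -g) ^ N = mk q * mk (-g) ^ N := by
        rw [map_mul, mul_pow, ← map_pow, h2]
      rw [e2]; simp only [map_mul, map_pow]; ring
    rw [h3]
    have : ∀ q' ∈ p.map (C : B →+* B[X]), mk (X ^ k) * mk q' ∈ p • U := by
      intro q' hq'
      refine Submodule.span_induction (p := fun q' _ => mk (X ^ k) * mk q' ∈ p • U)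
        ?_ ?_ ?_ ?_ hq'
      · rintro _ ⟨b, hb, rfl⟩
        have : mk (X ^ k) * mk (C b) = b • (mk (X ^ k) * mk 1) := by
          rw [Algebra.smul_def, map_one, mul_one, mul_comm]
          congr 1; exact mk.commutes b
        rw [this]
        exact Submodule.smul_mem_smul hb ⟨_, rfl⟩
      · simp
      · intro x y _ _ hx hy; rw [map_add, mul_add]; exact add_mem hx hy
      · intro a x _ hx
        rw [smul_eq_mul, map_mul, mul_left_comm]
        generalize hy : mk (X ^ k) * mk x = y at hx
        clear hy
        refine Submodule.smul_induction_on hx ?_ ?_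
        · rintro b hb _ ⟨n, rfl⟩
          rw [mul_smul_comm]
          refine Submodule.smul_mem_smul hb ⟨mk a * n, ?_⟩
          simp only [LinearMap.mulLeft_apply]; ring
        · intro x y hx hy; rw [mul_add]; exact add_mem hx hy
    exact this _ (Ideal.mul_mem_right _ _ hq)
  have hle : LinearMap.range ((s ^ N) • (LinearMap.id : U →ₗ[B] U)) ≤ p • (⊤ : Submodule B U) := by
    rintro _ ⟨u, rfl⟩
    have := key u u.2
    have e : p • U = Submodule.map U.subtype (p • ⊤) := by
      rw [Submodule.map_smul'']; simp
    rw [e] at this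
    obtain ⟨w, hw, hwu⟩ := this
    have e3 : ((s ^ N) • (LinearMap.id : U →ₗ[B] U)) u = w := Subtype.ext hwu.symm
    rw [e3]; exact hw
  obtain ⟨P, hP, -, hc, h0⟩ :=
    LinearMap.exists_monic_and_natDegree_eq_and_coeff_mem_pow_and_aeval_eq_zero
       B _ p hle
  refine ⟨P.eval (s ^ N), ?_, ?_⟩
  · intro hmem
    rw [Polynomial.eval_eq_sum_range, Finset.sum_range_succ, hP.coeff_natDegree, one_mul] at hmem
    have : ∑ i ∈ Finset.range P.natDegree, P.coeff i * (s ^ N) ^ i ∈ p := by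
      refine Ideal.sum_mem _ fun i hi => Ideal.mul_mem_right _ _ ?_
      exact Ideal.pow_le_self (by have := Finset.mem_range.1 hi; omega) (hc i)
    have := (Ideal.add_mem_iff_right _ this).1 hmem
    exact hs (Ideal.IsPrime.mem_of_pow_mem inferInstance _
      (Ideal.IsPrime.mem_of_pow_mem inferInstance _ this))
  · have e : Polynomial.aeval ((s ^ N) • (LinearMap.id : U →ₗ[B] U)) P
      = P.eval (s ^ N) • LinearMap.id := by
      have : (s ^ N) • (LinearMap.id : U →ₗ[B] U) = algebraMap B (Module.End B U) (s ^ N) := by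
        rw [Algebra.algebraMap_eq_smul_one]; rfl
      rw [this, Polynomial.aeval_algebraMap_apply, Algebra.algebraMap_eq_smul_one]
      simp; rfl
    rw [e] at h0
    have h5 := congrArg (fun F => (F ⟨mk (X ^ k) * mk 1, ⟨_, rfl⟩⟩ : M)) h0
    have h6 : P.eval (s ^ N) • (mk (X ^ k)) = 0 := by simpa using h5
    rw [← map_smul, Polynomial.smul_eq_C_mul] at h6
    exact h6

lemma exists_annihilator {B : Type} [CommRing B] (p : Ideal B) [p.IsPrime] (I : Ideal B[X])
    (z : B[X]) (hz : z.Monic) (hzI : z ∈ I) (k N : ℕ) (s : B) (hs : s ∉ p) (g : B[X])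
    (hI : X ^ k * (C s + X * g) ∈ I) (q : B[X]) (hq : q ∈ p.map (C : B →+* B[X]))
    (hN : X ^ N - q ∈ I) : ∃ f : B, f ∉ p ∧ C f * X ^ k ∈ I := by
  have hfin : Module.Finite B (B[X] ⧸ I) := by
    have h1 : Module.Finite B (B[X] ⧸ Ideal.span {z}) := hz.finite_quotient
    have hle : Ideal.span {z} ≤ I := by rw [Ideal.span_singleton_le_iff_mem]; exact hzI
    exact Module.Finite.of_surjective (Ideal.Quotient.factorₐ B hle).toLinearMap
      (Ideal.Quotient.factor_surjective hle)
  obtain ⟨f, hf, hf'⟩ := exists_annihilator_aux (Ideal.Quotient.mkₐ B I)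
    (Ideal.Quotient.mkₐ_surjective B I) p k N s hs g (Ideal.Quotient.eq_zero_iff_mem.2 hI) q hq
    (by rw [← sub_eq_zero, ← map_sub]; exact Ideal.Quotient.eq_zero_iff_mem.2 hN)
  exact ⟨f, hf, Ideal.Quotient.eq_zero_iff_mem.1 hf'⟩

/-- Producing completable rows over a local ring from the test ring. -/
lemma completable_from_test {A B : Type} [CommRing A] [IsLocalRing A] [CommRing B] (φ : B →+* A)
    {r : ℕ} (i1 : Fin (r + 1)) (hi1 : i1 ≠ 0)
    (hB : ∀ a : Fin (r + 1) → B[X], IsUnimodular a →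
      (∀ i, (a i).eval 0 = if i = 0 then 1 else 0) → IsCompletable a)
    (k : ℕ) (P Q : Fin (r + 1) → B[X]) (hP : ∀ i, (P i).natDegree ≤ k)
    (s : B) (hs : IsUnit (φ s)) (g : B[X]) (hPQ : ∑ i, P i * Q i = X ^ k * (C s + X * g))
    (h1 : ∀ j, φ ((P i1).coeff j) ∈ IsLocalRing.maximalIdeal A) :
    IsCompletable (fun i => reflect (k + 2) ((P i).map φ) + (if i = 0 then 1 else 0)
      + (if i = i1 then X else 0) : Fin (r + 1) → A[X]) := by
  classical
  set p : Ideal B := (IsLocalRing.maximalIdeal A).comap φ with hp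
  have hpp : p.IsPrime := Ideal.comap_isPrime _ _
  let z : Fin (r + 1) → B[X] := fun i =>
    P i + (if i = 0 then X ^ (k + 2) else 0) + (if i = i1 then X ^ (k + 1) else 0)
  let a : Fin (r + 1) → B[X] := fun i =>
    reflect (k + 2) (P i) + (if i = 0 then 1 else 0) + (if i = i1 then X else 0)
  have hza : ∀ i, reflect (k + 2) (z i) = a i := by
    intro i
    simp only [z, a, reflect_add]
    congr 1
    · congr 1
      split_ifs
      · rw [reflect_monomial, revAt_le le_rfl]; simp
      · simp
    · split_ifs
      · rw [reflect_monomial, revAt_le (by omega)]; simp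
      · simp
  have hzd : ∀ i, (z i).natDegree ≤ k + 2 := by
    intro i
    refine natDegree_add_le_of_degree_le (natDegree_add_le_of_degree_le
      ((hP i).trans (by omega)) ?_) ?_
    · split_ifs
      · exact natDegree_X_pow_le _
      · simp
    · split_ifs
      · exact (natDegree_X_pow_le _).trans (by omega)
      · simp
  have ha0 : ∀ i, (a i).eval 0 = if i = 0 then 1 else 0 := by
    intro i
    have : (P i).coeff (k + 2) = 0 := coeff_eq_zero_of_natDegree_lt (by have := hP i; omega)
    simp only [a, eval_add, ← coeff_zero_eq_eval_zero, coeff_reflect, revAt_le (Nat.zero_le _)]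
    simp only [Nat.sub_zero, this]
    split_ifs <;> simp
  let I : Ideal B[X] := Ideal.span (Set.range z)
  have hzI : ∀ i, z i ∈ I := fun i => Ideal.subset_span ⟨i, rfl⟩
  have hmonic : (z 0).Monic := by
    have e : z 0 = X ^ (k + 2) + P 0 := by simp [z, hi1.symm, add_comm]
    rw [e]
    refine monic_X_pow_add ?_
    refine lt_of_le_of_lt degree_le_natDegree ?_
    have := hP 0
    exact_mod_cast (by omega : (P 0).natDegree < k + 2)
  have hI2 : X ^ k * (C s + X * (g + X * Q 0 + Q i1)) ∈ I := by
    have : X ^ k * (C s + X * (g + X * Q 0 + Q i1)) = ∑ i, z i * Q i := by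
      simp only [z, add_mul, Finset.sum_add_distrib, hPQ, ite_mul, zero_mul,
        Finset.sum_ite_eq', Finset.mem_univ, if_true]
      ring
    rw [this]
    exact Ideal.sum_mem _ fun i _ => Ideal.mul_mem_right _ _ (hzI i)
  have hI3 : X ^ (k + 1) - (- P i1) ∈ I := by
    have : X ^ (k + 1) - (- P i1) = z i1 := by simp [z, hi1, add_comm]
    rw [this]; exact hzI i1
  obtain ⟨f, hf, hfI⟩ := exists_annihilator p I (z 0) hmonic (hzI 0) k (k + 1) s
    (by rw [hp, Ideal.mem_comap]; exact fun h => (IsLocalRing.mem_maximalIdeal _).1 h hs)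
    _ hI2 (- P i1) (by
      rw [neg_mem_iff, Ideal.mem_map_C_iff]
      exact fun n => h1 n) hI3
  -- `f * X ^ j` lies in the ideal generated by `a`
  obtain ⟨c, hc⟩ := (Ideal.mem_span_range_iff_exists_fun).1 hfI
  let E : ℕ := k + Finset.univ.sup fun i => (c i).natDegree
  have hE : ∀ i, (c i).natDegree ≤ E := fun i =>
    (Finset.le_sup (f := fun i => (c i).natDegree) (Finset.mem_univ i)).trans (by omega)
  let J : Ideal B[X] := Ideal.span (Set.range a)
  have haJ : ∀ i, a i ∈ J := fun i => Ideal.subset_span ⟨i, rfl⟩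
  have hfJ : C f * X ^ (E + (k + 2) - k) ∈ J := by
    have h3 := congrArg (reflect (E + (k + 2))) hc
    rw [reflect_C_mul_X_pow, revAt_le (by omega)] at h3
    rw [← h3]
    have : reflect (E + (k + 2)) (∑ i, c i * z i) = ∑ i, reflect (E + (k + 2)) (c i * z i) := by
      ext j; simp only [coeff_reflect, finsetSum_coeff]
    rw [this]
    refine Ideal.sum_mem _ fun i _ => ?_
    rw [reflect_mul _ _ (hE i) (hzd i), hza]
    exact Ideal.mul_mem_left _ _ (haJ i)
  obtain ⟨a', ha'⟩ : ∃ a', a 0 = 1 + X * a' := by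
    have : X ∣ a 0 - 1 := by
      rw [X_dvd_iff, coeff_zero_eq_eval_zero, eval_sub, ha0]; simp
    obtain ⟨a', h⟩ := this
    exact ⟨a', by rw [← h]; ring⟩
  have hfJ' : C f ∈ J := by
    have hcop : IsCoprime (a 0) (X ^ (E + (k + 2) - k)) := by
      apply IsCoprime.pow_right
      exact ⟨1, -a', by rw [ha']; ring⟩
    obtain ⟨u, w, huw⟩ := hcop
    have : C f = (C f * u) * a 0 + w * (C f * X ^ (E + (k + 2) - k)) := by
      calc C f = C f * (u * a 0 + w * X ^ (E + (k + 2) - k)) := by rw [huw, mul_one]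
        _ = _ := by ring
    rw [this]
    exact add_mem (Ideal.mul_mem_left _ _ (haJ 0)) (Ideal.mul_mem_left _ _ hfJ)
  -- rescale
  let b : Fin (r + 1) → B[X] := fun i => (a i).comp (C f * X)
  have hb : IsUnimodular b := by
    unfold IsUnimodular
    rw [Ideal.eq_top_iff_one]
    have hbJ : ∀ i, b i ∈ Ideal.span (Set.range b) := fun i => Ideal.subset_span ⟨i, rfl⟩
    obtain ⟨c, hc⟩ := (Ideal.mem_span_range_iff_exists_fun).1 hfJ'
    have hfb : C f ∈ Ideal.span (Set.range b) := by
      have := congrArg (compRingHom (C f * X)) hc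
      rw [map_sum] at this
      simp only [map_mul, coe_compRingHom_apply, C_comp] at this
      rw [← this]
      exact Ideal.sum_mem _ fun i _ => Ideal.mul_mem_left _ _ (hbJ i)
    have : (1 : B[X]) = b 0 - (X * a'.comp (C f * X)) * C f := by
      simp only [b, ha']; simp; ring
    rw [this]
    exact sub_mem (hbJ 0) (Ideal.mul_mem_left _ _ hfb)
  have hb0 : ∀ i, (b i).eval 0 = if i = 0 then 1 else 0 := by
    intro i; rw [← ha0]; simp [b]
  have hcomp := completable_map (mapRingHom φ) (hB b hb hb0)
  have hfu : IsUnit (φ f) := by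
    by_contra h; exact hf ((IsLocalRing.mem_maximalIdeal _).2 h)
  obtain ⟨u, hu⟩ := hfu
  have h5 := completable_map (compRingHom (C (↑u⁻¹ : A) * X)) hcomp
  convert h5 using 2 with i
  simp only [coe_mapRingHom, coe_compRingHom_apply, b, Polynomial.map_comp]
  rw [comp_assoc]
  have : ((C f * X).map φ).comp (C (↑u⁻¹ : A) * X) = X := by
    simp only [Polynomial.map_mul, map_C, map_X, mul_comp, C_comp, X_comp, ← mul_assoc, ← C_mul,
      ← hu, Units.mul_inv, C_1, one_mul]
  rw [this, comp_X]
  simp only [a, Polynomial.map_add, reflect_map]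
  congr 1
  · congr 1
    split_ifs <;> simp
  · split_ifs <;> simp

/-- Applying the test ring. -/
lemma completable_twisted (R : Type) [CommRing R] (r : ℕ) (i1 : Fin (r + 1)) (hi1 : i1 ≠ 0)
    (h : ∀ k n : ℕ, ∀ a : Fin (r + 1) → Polynomial (BFin R r k n), IsUnimodular a →
      (∀ i, (a i).eval 0 = if i = 0 then 1 else 0) → IsCompletable a)
    (A : Type) [CommRing A] [IsLocalRing A] [Algebra R A] (v w : Fin (r + 1) → A[X])
    (hvw : ∑ i, v i * w i = 1) (h1 : ∀ j, (v i1).coeff j ∈ IsLocalRing.maximalIdeal A)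
    (e : ℕ) (he : ∀ i, (w i).natDegree ≤ e) :
    IsCompletable (fun i => X ^ (e + 2) * v i + (if i = 0 then 1 else 0)
      + (if i = i1 then X else 0) : Fin (r + 1) → A[X]) := by
  classical
  let d : ℕ := Finset.univ.sup fun i => (v i).natDegree
  have hd : ∀ i, (v i).natDegree ≤ d := fun i =>
    Finset.le_sup (f := fun i => (v i).natDegree) (Finset.mem_univ i)
  let k := d + e
  let xA : Fin (r + 1) → A[X] := fun i => reflect d (v i)
  let yA : Fin (r + 1) → A[X] := fun i => reflect e (w i)
  have hxy : ∑ i, xA i * yA i = X ^ k := by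
    have : ∀ i, xA i * yA i = reflect k (v i * w i) := fun i =>
      (reflect_mul _ _ (hd i) (he i)).symm
    simp only [this]
    have h3 : reflect k (∑ i, v i * w i) = ∑ i, reflect k (v i * w i) := by
      ext j; simp only [coeff_reflect, finsetSum_coeff]
    rw [← h3, hvw, reflect_one]
  have hxd : ∀ i, (xA i).natDegree ≤ k := fun i =>
    (natDegree_reflect_le).trans (max_le (by omega) ((hd i).trans (by omega)))
  have hyd : ∀ i, (yA i).natDegree ≤ k := fun i =>
    (natDegree_reflect_le).trans (max_le (by omega) ((he i).trans (by omega)))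
  let ev : FinVars r k → A := Sum.elim (fun q => (xA q.1).coeff q.2) (fun q => (yA q.1).coeff q.2)
  let φ₀ : MvPolynomial (FinVars r k) R →+* A := (MvPolynomial.aeval ev).toRingHom
  have hφp : ∀ ℓ : Fin (k + 1), φ₀ (pFin R r k ℓ) = if (ℓ : ℕ) = k then 1 else 0 := by
    intro ℓ
    have h3 : φ₀ (pFin R r k ℓ) = (∑ i, xA i * yA i).coeff ℓ := by
      simp only [pFin, φ₀, ev, finsetSum_coeff, coeff_mul, AlgHom.toRingHom_eq_coe,
        RingHom.coe_coe, map_sum, map_mul, MvPolynomial.aeval_X, Sum.elim_inl, Sum.elim_inr]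
      refine Finset.sum_congr rfl fun i _ => ?_
      rw [Finset.Nat.sum_antidiagonal_eq_sum_range_succ
        (fun a b => (xA i).coeff a * (yA i).coeff b), Finset.sum_range]
    rw [h3, hxy, coeff_X_pow]
  let φ : BFin R r k k →+* A := Ideal.Quotient.lift (JFin R r k k) φ₀ (by
    intro a ha
    refine Submodule.span_induction (p := fun a _ => φ₀ a = 0) ?_ (map_zero _) ?_ ?_ ha
    · rintro _ ⟨ℓ, hℓ, rfl⟩; rw [hφp, if_neg hℓ]
    · intro x y _ _ hx hy; rw [map_add, hx, hy, add_zero]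
    · intro x y _ hy; rw [smul_eq_mul, map_mul, hy, mul_zero])
  let π : MvPolynomial (FinVars r k) R →+* BFin R r k k := Ideal.Quotient.mk (JFin R r k k)
  have hφπ : ∀ q, φ (π q) = φ₀ q := fun q => Ideal.Quotient.lift_mk _ _ _
  have hπp : ∀ ℓ : Fin (k + 1), (ℓ : ℕ) ≠ k → π (pFin R r k ℓ) = 0 := fun ℓ hℓ =>
    Ideal.Quotient.eq_zero_iff_mem.2 (Ideal.subset_span ⟨ℓ, hℓ, rfl⟩)
  let P : Fin (r + 1) → (BFin R r k k)[X] := fun i =>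
    ∑ j : Fin (k + 1), C (π (MvPolynomial.X (Sum.inl (i, j)))) * X ^ (j : ℕ)
  let Q : Fin (r + 1) → (BFin R r k k)[X] := fun i =>
    ∑ j : Fin (k + 1), C (π (MvPolynomial.X (Sum.inr (i, j)))) * X ^ (j : ℕ)
  have hPc : ∀ i (j : ℕ) (hj : j < k + 1), (P i).coeff j
      = π (MvPolynomial.X (Sum.inl (i, ⟨j, hj⟩))) := by
    intro i j hj
    simp only [P, finsetSum_coeff, coeff_C_mul, coeff_X_pow]
    rw [Finset.sum_eq_single ⟨j, hj⟩]
    · simp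
    · intro b _ hb
      rw [if_neg, mul_zero]
      intro h; exact hb (Fin.ext h.symm)
    · simp
  have hQc : ∀ i (j : ℕ) (hj : j < k + 1), (Q i).coeff j
      = π (MvPolynomial.X (Sum.inr (i, ⟨j, hj⟩))) := by
    intro i j hj
    simp only [Q, finsetSum_coeff, coeff_C_mul, coeff_X_pow]
    rw [Finset.sum_eq_single ⟨j, hj⟩]
    · simp
    · intro b _ hb
      rw [if_neg, mul_zero]
      intro h; exact hb (Fin.ext h.symm)
    · simp
  have hPd : ∀ i, (P i).natDegree ≤ k := by
    intro i
    refine natDegree_sum_le_of_forall_le _ _ fun j _ => ?_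
    exact (natDegree_C_mul_X_pow_le _ _).trans (by omega)
  have hPmap : ∀ i, (P i).map φ = xA i := by
    intro i
    ext j
    rw [coeff_map]
    by_cases hj : j < k + 1
    · rw [hPc i j hj, hφπ]; simp [φ₀, ev]
    · rw [coeff_eq_zero_of_natDegree_lt (by have := hPd i; omega),
        coeff_eq_zero_of_natDegree_lt (by have := hxd i; omega), map_zero]
  have hPQc : ∀ ℓ : Fin (k + 1), (∑ i, P i * Q i).coeff ℓ = π (pFin R r k ℓ) := by
    intro ℓ
    simp only [pFin, finsetSum_coeff, coeff_mul, map_sum, map_mul]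
    refine Finset.sum_congr rfl fun i _ => ?_
    rw [Finset.Nat.sum_antidiagonal_eq_sum_range_succ
        (fun a b => (P i).coeff a * (Q i).coeff b), Finset.sum_range]
    refine Finset.sum_congr rfl fun j _ => ?_
    rw [hPc, hQc]
  let s := π (pFin R r k (Fin.last k))
  obtain ⟨g, hg⟩ : ∃ g, ∑ i, P i * Q i = X ^ k * (C s + X * g) := by
    have h1 : X ^ k ∣ ∑ i, P i * Q i := by
      rw [X_pow_dvd_iff]
      intro j hj
      rw [hPQc ⟨j, by omega⟩, hπp _ (by simp; omega)]
    obtain ⟨q, hq⟩ := h1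
    have h2 : X ∣ q - C s := by
      rw [X_dvd_iff, coeff_sub, coeff_C_zero, sub_eq_zero]
      have := hPQc (Fin.last k)
      rw [hq, Fin.val_last] at this
      simpa [coeff_X_pow_mul'] using this
    obtain ⟨g, hg⟩ := h2
    exact ⟨g, by rw [hq, ← hg]; ring⟩
  have := completable_from_test φ i1 hi1 (h k k) k P Q hPd s
    (by simp only [s]; rw [hφπ, hφp]; simp) g hg (by
      intro j
      rw [← coeff_map, hPmap]
      simp only [xA, coeff_reflect]
      exact h1 _)
  convert this using 4 with i
  rw [hPmap]
  have e1 : k + 2 = (e + 2) + d := by simp only [k]; omega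
  have := reflect_mul (1 : A[X]) (xA i) (F := e + 2) (G := d) (by simp)
    ((natDegree_reflect_le).trans (max_le le_rfl (hd i)))
  rw [e1, ← one_mul (xA i), this, reflect_one]
  simp [xA]

lemma isUnit_clear {S : Type} [CommRing S] {n : ℕ} (i : Fin n) (q : Fin n → S) (hq : q i = 0) :
    IsUnit (1 - Matrix.vecMulVec (Pi.single i 1) q : Matrix (Fin n) (Fin n) S) := by
  have h0 : Matrix.vecMulVec (Pi.single i 1) q * Matrix.vecMulVec (Pi.single i 1) q = 0 := by
    rw [Matrix.vecMulVec_mul_vecMulVec]; simp [hq]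
  have h1 : (1 + Matrix.vecMulVec (Pi.single i 1) q) *
      (1 - Matrix.vecMulVec (Pi.single i 1) q : Matrix (Fin n) (Fin n) S) = 1 := by
    rw [add_mul, mul_sub, mul_sub, h0]; simp
  exact ⟨⟨_, _, mul_eq_one_comm.1 h1, h1⟩, rfl⟩

lemma vecMul_clear {S : Type} [CommRing S] {n : ℕ} (i : Fin n) (q u : Fin n → S) (j : Fin n) :
    Matrix.vecMul u (1 - Matrix.vecMulVec (Pi.single i 1) q) j = u j - u i * q j := by
  rw [Matrix.vecMul_sub, Matrix.vecMul_one, Matrix.vecMul_vecMulVec]; simp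

/-- Euclidean reduction of the residue row. -/
lemma exists_reduce {A : Type} [CommRing A] [IsLocalRing A] {r : ℕ} (v : Fin (r + 1) → A[X])
    (hv : IsUnimodular v) : ∃ M : Matrix (Fin (r + 1)) (Fin (r + 1)) A[X], IsUnit M ∧
      ∀ i, (Matrix.vecMul v M i).map (IsLocalRing.residue A) = if i = 0 then 1 else 0 := by
  classical
  let K := IsLocalRing.ResidueField A
  let π : A[X] →+* K[X] := mapRingHom (IsLocalRing.residue A)
  have hπ : Function.Surjective π := Polynomial.map_surjective _ IsLocalRing.residue_surjective
  have huni : ∀ M : Matrix (Fin (r + 1)) (Fin (r + 1)) A[X], IsUnit M →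
      ∃ w : Fin (r + 1) → K[X], ∑ i, π (Matrix.vecMul v M i) * w i = 1 := by
    rintro _ ⟨M, rfl⟩
    obtain ⟨w, hw⟩ := (unimodular_iff v).1 hv
    refine ⟨fun i => π (Matrix.mulVec (↑M⁻¹ : Matrix (Fin (r + 1)) (Fin (r + 1)) A[X]) w i), ?_⟩
    have : dotProduct (Matrix.vecMul v ↑M)
        (Matrix.mulVec (↑M⁻¹ : Matrix (Fin (r + 1)) (Fin (r + 1)) A[X]) w) = 1 := by
      rw [← Matrix.dotProduct_mulVec, Matrix.mulVec_mulVec]; simpa [dotProduct] using hw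
    have := congrArg π this
    simpa [dotProduct, map_sum, map_mul] using this
  let S : Set ℕ := {d | ∃ M : Matrix (Fin (r + 1)) (Fin (r + 1)) A[X], IsUnit M ∧
    ∃ i, π (Matrix.vecMul v M i) ≠ 0 ∧ (π (Matrix.vecMul v M i)).natDegree = d}
  have hS : S.Nonempty := by
    obtain ⟨w, hw⟩ := huni 1 isUnit_one
    by_contra hne
    have : ∀ i, π (Matrix.vecMul v (1 : Matrix (Fin (r + 1)) (Fin (r + 1)) A[X]) i) = 0 := by
      intro i; by_contra hi
      exact hne ⟨_, 1, isUnit_one, i, hi, rfl⟩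
    simp only [this, zero_mul, Finset.sum_const_zero] at hw
    exact zero_ne_one hw
  obtain ⟨M, hM, i, hi, hdeg⟩ := Nat.sInf_mem hS
  have hmin : ∀ M' : Matrix (Fin (r + 1)) (Fin (r + 1)) A[X], IsUnit M' → ∀ j,
      π (Matrix.vecMul v M' j) ≠ 0 →
      (π (Matrix.vecMul v M i)).natDegree ≤ (π (Matrix.vecMul v M' j)).natDegree := by
    intro M' hM' j hj
    rw [hdeg]; exact Nat.sInf_le ⟨M', hM', j, hj, rfl⟩
  set u := Matrix.vecMul v M with hu
  choose q hq using fun j => hπ (π (u j) / π (u i))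
  let q' : Fin (r + 1) → A[X] := fun j => if j = i then 0 else q j
  let M1 := M * (1 - Matrix.vecMulVec (Pi.single i 1) q')
  have hM1 : IsUnit M1 := hM.mul (isUnit_clear i q' (by simp [q']))
  have hM1v : ∀ j, Matrix.vecMul v M1 j = u j - u i * q' j := by
    intro j; rw [← Matrix.vecMul_vecMul, vecMul_clear]
  have h0 : ∀ j, j ≠ i → π (Matrix.vecMul v M1 j) = 0 := by
    intro j hj
    by_contra hne
    have hle := hmin M1 hM1 j hne
    have e : π (Matrix.vecMul v M1 j) = π (u j) % π (u i) := by
      rw [hM1v]; simp only [q', if_neg hj, map_sub, map_mul, hq]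
      rw [EuclideanDomain.mod_eq_sub_mul_div]
    rw [e] at hle hne
    have := EuclideanDomain.mod_lt (π (u j)) hi
    have := Polynomial.natDegree_lt_natDegree hne this
    omega
  have hi' : Matrix.vecMul v M1 i = u i := by rw [hM1v]; simp [q']
  have hunit : IsUnit (π (u i)) := by
    obtain ⟨w, hw⟩ := huni M1 hM1
    rw [Finset.sum_eq_single i (fun j _ hj => by rw [h0 j hj, zero_mul]) (by simp), hi'] at hw
    exact IsUnit.of_mul_eq_one _ hw
  obtain ⟨c, hc, hcu⟩ := Polynomial.isUnit_iff.1 hunit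
  obtain ⟨c', rfl⟩ := IsLocalRing.residue_surjective c
  have hc' : IsUnit c' := (isUnit_map_iff (IsLocalRing.residue A) c').1 hc
  obtain ⟨c', rfl⟩ := hc'
  let σ : Equiv.Perm (Fin (r + 1)) := Equiv.swap 0 i
  let D : Matrix (Fin (r + 1)) (Fin (r + 1)) A[X] := Matrix.diagonal fun _ => C (↑c'⁻¹ : A)
  have hD : IsUnit D := by
    have h1 : (Matrix.diagonal fun _ => C (↑c' : A) :
        Matrix (Fin (r + 1)) (Fin (r + 1)) A[X]) * D = 1 := by
      rw [Matrix.diagonal_mul_diagonal]; simp [← C_mul]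
    exact ⟨⟨_, _, mul_eq_one_comm.1 h1, h1⟩, rfl⟩
  refine ⟨(M1 * D).submatrix id σ, ?_, ?_⟩
  · exact (Matrix.isUnit_submatrix_equiv (A := M1 * D) (Equiv.refl _) σ).2 (hM1.mul hD)
  · intro j
    have e : Matrix.vecMul v ((M1 * D).submatrix id σ) j
        = Matrix.vecMul v M1 (σ j) * C (↑c'⁻¹ : A) := by
      have : Matrix.vecMul v ((M1 * D).submatrix id σ) j = Matrix.vecMul v (M1 * D) (σ j) := rfl
      rw [this, ← Matrix.vecMul_vecMul]
      simp only [D, Matrix.vecMul_diagonal]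
    rw [e]
    change π _ = _
    by_cases hj : j = 0
    · subst hj
      have : σ 0 = i := Equiv.swap_apply_left _ _
      rw [this, hi', map_mul, ← hcu, if_pos rfl]
      simp only [π, coe_mapRingHom, map_C, ← map_mul]
      simp
    · rw [if_neg hj, map_mul, h0, zero_mul]
      intro h
      apply hj
      have : σ (σ j) = σ i := by rw [h]
      simpa [σ] using this

/-! ### Laurent series tools -/

/-- The embedding `A[X] → A((t))`, `X ↦ t⁻¹`. -/
noncomputable def iotaL (A : Type) [CommRing A] : A[X] →+* HahnSeries ℤ A :=
  eval₂RingHom HahnSeries.C (HahnSeries.single (-1) 1)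

lemma single_neg_pow {A : Type} [CommRing A] (j : ℕ) :
    (HahnSeries.single (-1 : ℤ) (1 : A)) ^ j = HahnSeries.single (-(j : ℤ)) 1 := by
  rw [HahnSeries.single_pow]; simp

lemma iotaL_coeff {A : Type} [CommRing A] (p : A[X]) (n : ℤ) :
    (iotaL A p).coeff n = if n ≤ 0 then p.coeff n.natAbs else 0 := by
  induction p using Polynomial.induction_on' with
  | add p q hp hq => rw [map_add, HahnSeries.coeff_add, hp, hq]; split_ifs <;> simp
  | monomial j a =>
    have : iotaL A (monomial j a) = HahnSeries.single (-(j : ℤ)) a := by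
      simp only [iotaL, coe_eval₂RingHom, eval₂_monomial, single_neg_pow, HahnSeries.C_apply]
      rw [HahnSeries.single_mul_single]; simp
    rw [this, HahnSeries.coeff_single, coeff_monomial]
    split_ifs <;> first | rfl | omega

/-- The polynomial part. -/
noncomputable def polyPart (A : Type) [CommRing A] : HahnSeries ℤ A →ₗ[A] A[X] := by
  have key : ∀ x : HahnSeries ℤ A, ∀ n : ℕ,
      (∑ j ∈ Finset.range (x.order.natAbs + 1), monomial j (x.coeff (-(j : ℤ)))).coeff n
        = x.coeff (-(n : ℤ)) := by
    intro x n
    simp only [finsetSum_coeff, coeff_monomial, Finset.sum_ite_eq', Finset.mem_range]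
    split_ifs with h
    · rfl
    · exact (HahnSeries.coeff_eq_zero_of_lt_order (by omega)).symm
  exact
  { toFun := fun x => ∑ j ∈ Finset.range (x.order.natAbs + 1), monomial j (x.coeff (-(j : ℤ)))
    map_add' := fun x y => by ext n; rw [coeff_add, key, key, key]; simp
    map_smul' := fun a x => by ext n; rw [coeff_smul, key, RingHom.id_apply, key]; simp }

lemma polyPart_coeff {A : Type} [CommRing A] (x : HahnSeries ℤ A) (n : ℕ) :
    (polyPart A x).coeff n = x.coeff (-(n : ℤ)) := by
  change (∑ j ∈ Finset.range (x.order.natAbs + 1), monomial j (x.coeff (-(j : ℤ)))).coeff n = _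
  simp only [finsetSum_coeff, coeff_monomial, Finset.sum_ite_eq', Finset.mem_range]
  split_ifs with h
  · rfl
  · exact (HahnSeries.coeff_eq_zero_of_lt_order (by omega)).symm

lemma polyPart_iotaL {A : Type} [CommRing A] (p : A[X]) : polyPart A (iotaL A p) = p := by
  ext n; rw [polyPart_coeff, iotaL_coeff, if_pos (by omega)]; simp

lemma iotaL_smul {A : Type} [CommRing A] (a : A) (p : A[X]) :
    iotaL A (a • p) = a • iotaL A p := by
  ext n; simp only [HahnSeries.coeff_smul, iotaL_coeff, coeff_smul]; split_ifs <;> simp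

/-- Coefficientwise map. -/
noncomputable def mapL {A B : Type} [CommRing A] [CommRing B] (f : A →+* B) :
    HahnSeries ℤ A →+* HahnSeries ℤ B where
  toFun x := x.map f
  map_one' := HahnSeries.map_one f.toMonoidWithZeroHom
  map_mul' x y := HahnSeries.map_mul f.toNonUnitalRingHom
  map_zero' := by ext; simp
  map_add' x y := by ext; simp

lemma mapL_coeff {A B : Type} [CommRing A] [CommRing B] (f : A →+* B) (x : HahnSeries ℤ A)
    (n : ℤ) : (mapL f x).coeff n = f (x.coeff n) := rfl

/-- vanishing of nonpositive coefficients -/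
def IsPosL {A : Type} [CommRing A] (x : HahnSeries ℤ A) : Prop := ∀ n : ℤ, n ≤ 0 → x.coeff n = 0

lemma coeff_mul_zero_of_bounds {A : Type} [CommRing A] {x y : HahnSeries ℤ A} {a b : ℤ}
    (hx : ∀ n < a, x.coeff n = 0) (hy : ∀ n < b, y.coeff n = 0) (n : ℤ) (hn : n < a + b) :
    (x * y).coeff n = 0 := by
  rw [HahnSeries.coeff_mul]
  refine Finset.sum_eq_zero fun ij hij => ?_
  rw [Finset.mem_antidiagonal] at hij
  by_cases h : ij.1 < a
  · rw [hx _ h, zero_mul]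
  · rw [hy ij.2 (by omega), mul_zero]

lemma isPosL_iff {A : Type} [CommRing A] (x : HahnSeries ℤ A) :
    IsPosL x ↔ polyPart A x = 0 := by
  constructor
  · intro h; ext n; rw [polyPart_coeff, h _ (by omega)]; simp
  · intro h n hn
    have := congrArg (fun p => p.coeff n.natAbs) h
    simp only [polyPart_coeff, coeff_zero] at this
    rwa [show -(n.natAbs : ℤ) = n by omega] at this

lemma isUnit_of_isPosL {A : Type} [CommRing A] {n : ℕ} (b : Matrix (Fin n) (Fin n) (HahnSeries ℤ A))
    (h : ∀ i j, IsPosL ((b - 1) i j)) : IsUnit b := by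
  let P : Matrix (Fin n) (Fin n) (PowerSeries A) := fun i j => PowerSeries.mk fun k =>
    (b i j).coeff (k : ℤ)
  have hP : b = P.map (HahnSeries.ofPowerSeries ℤ A) := by
    ext i j m
    rw [Matrix.map_apply]
    by_cases hm : 0 ≤ m
    · obtain ⟨k, rfl⟩ := Int.eq_ofNat_of_zero_le hm
      have := HahnSeries.ofPowerSeries_apply_coeff (Γ := ℤ) (P i j) k
      simp only [P] at this ⊢
      exact (this.trans (PowerSeries.coeff_mk _ _)).symm
    · have h1 := h i j m (by omega)
      rw [HahnSeries.ofPowerSeries_apply, HahnSeries.embDomain_of_notMem_range]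
      · rw [Matrix.sub_apply, HahnSeries.coeff_sub, Matrix.one_apply] at h1
        have : (if i = j then (1 : HahnSeries ℤ A) else 0).coeff m = 0 := by
          split_ifs
          · rw [HahnSeries.coeff_one, if_neg (by omega)]
          · simp
        rwa [this, sub_zero] at h1
      · rintro ⟨k, hk⟩
        simp at hk; omega
  have hu : IsUnit P := by
    rw [Matrix.isUnit_iff_isUnit_det, PowerSeries.isUnit_iff_constantCoeff, RingHom.map_det]
    have : (PowerSeries.constantCoeff).mapMatrix P = (1 : Matrix (Fin n) (Fin n) A) := by
      ext i j
      have h1 := h i j 0 le_rfl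
      rw [Matrix.sub_apply, HahnSeries.coeff_sub, sub_eq_zero, Matrix.one_apply] at h1
      rw [Matrix.one_apply]
      change PowerSeries.constantCoeff (P i j) = _
      rw [show P i j = PowerSeries.mk fun k => (b i j).coeff (k : ℤ) from rfl, ← PowerSeries.coeff_zero_eq_constantCoeff_apply, PowerSeries.coeff_mk]
      simp only [Nat.cast_zero, h1]
      split_ifs <;> simp
    rw [this]; simp
  rw [hP]
  exact hu.map (HahnSeries.ofPowerSeries ℤ A).mapMatrix

lemma mapL_lift {A : Type} [CommRing A] [IsLocalRing A]
    (f : HahnSeries ℤ (IsLocalRing.ResidueField A)) :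
    ∃ x : HahnSeries ℤ A, mapL (IsLocalRing.residue A) x = f ∧ (f ≠ 0 → IsUnit x) := by
  classical
  choose s hs using IsLocalRing.residue_surjective (R := A)
  let g : ZeroHom (IsLocalRing.ResidueField A) A :=
    ⟨fun a => if a = 0 then 0 else s a, by simp⟩
  have hg : ∀ a, IsLocalRing.residue A (g a) = a := by
    intro a
    change IsLocalRing.residue A (if a = 0 then 0 else s a) = a
    split_ifs with h
    · rw [h, map_zero]
    · exact hs a
  have hx : mapL (IsLocalRing.residue A) (f.map g) = f := by
    ext n; rw [mapL_coeff, HahnSeries.map_coeff, hg]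
  refine ⟨f.map g, hx, fun hf => ?_⟩
  have hne : f.map g ≠ 0 := fun h => hf (by rw [← hx, h, map_zero])
  apply HahnSeries.isUnit_of_isUnit_leadingCoeff_AddUnitOrder
  · rw [HahnSeries.leadingCoeff_eq]
    have h1 : (f.map g).coeff (f.map g).order ≠ 0 := mt HahnSeries.coeff_order_eq_zero.1 hne
    rw [← isUnit_map_iff (IsLocalRing.residue A), isUnit_iff_ne_zero]
    rw [HahnSeries.map_coeff] at h1 ⊢
    rw [hg]
    intro h; rw [h] at h1; exact h1 (map_zero g)
  · exact AddGroup.isAddUnit _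

lemma lift_GL {L F : Type} [CommRing L] [Field F] (ρ : L →+* F)
    (hρ : ∀ f, ∃ x, ρ x = f ∧ (f ≠ 0 → IsUnit x)) {n : ℕ} (M : Matrix (Fin n) (Fin n) F)
    (hM : M.det ≠ 0) : ∃ T : Matrix (Fin n) (Fin n) L, IsUnit T ∧ T.map ρ = M := by
  refine Matrix.diagonal_transvection_induction_of_det_ne_zero
    (fun M => ∃ T : Matrix (Fin n) (Fin n) L, IsUnit T ∧ T.map ρ = M) M hM ?_ ?_ ?_
  · intro D hD
    choose x hx hxu using fun i => hρ (D i)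
    refine ⟨Matrix.diagonal x, ?_, ?_⟩
    · rw [Matrix.isUnit_diagonal, Pi.isUnit_iff]
      intro i
      apply hxu
      rw [Matrix.det_diagonal] at hD
      exact Finset.prod_ne_zero_iff.1 hD i (Finset.mem_univ _)
    · rw [Matrix.diagonal_map (map_zero ρ)]; congr 1; ext i; exact hx i
  · intro t
    obtain ⟨x, hx, -⟩ := hρ t.c
    refine ⟨Matrix.transvection t.i t.j x, ?_, ?_⟩
    · rw [Matrix.isUnit_iff_isUnit_det, Matrix.det_transvection_of_ne _ _ t.hij]
      exact isUnit_one
    · rw [Matrix.TransvectionStruct.toMatrix, Matrix.transvection, Matrix.transvection, ← hx]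
      have := map_add ρ.mapMatrix (1 : Matrix (Fin n) (Fin n) L) (Matrix.single t.i t.j x)
      rw [map_one] at this
      refine this.trans ?_
      simp [RingHom.mapMatrix_apply]
  · rintro M N - - ⟨T, hT, rfl⟩ ⟨U, hU, rfl⟩
    exact ⟨T * U, hT.mul hU, Matrix.map_mul⟩

lemma adjust_row {L F : Type} [CommRing L] [Field F] (ρ : L →+* F)
    (hρ : ∀ f, ∃ x, ρ x = f ∧ (f ≠ 0 → IsUnit x)) {r : ℕ}
    (G : Matrix (Fin (r + 1)) (Fin (r + 1)) L) (hG : IsUnit G)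
    (h0 : ∀ j, ρ (G 0 j) = if j = 0 then 1 else 0) :
    ∃ G' : Matrix (Fin (r + 1)) (Fin (r + 1)) L, IsUnit G' ∧ G' 0 = G 0 ∧ G'.map ρ = 1 := by
  classical
  have hdet : ∀ {S : Type} [CommRing S] (M : Matrix (Fin (r + 1)) (Fin (r + 1)) S),
      (∀ j, M 0 j = if j = 0 then 1 else 0) → M.det = (M.submatrix Fin.succ Fin.succ).det := by
    intro S _ M hM
    rw [Matrix.det_succ_row_zero, Finset.sum_eq_single 0]
    · rw [hM, if_pos rfl]; simp [Fin.succAbove_zero]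
    · intro j _ hj; rw [hM, if_neg hj]; simp
    · simp
  have hMu : IsUnit (G.map ρ) := hG.map ρ.mapMatrix
  have hMdet : ((G.map ρ).submatrix Fin.succ Fin.succ).det ≠ 0 := by
    rw [← hdet (G.map ρ) (fun j => h0 j)]
    exact ((Matrix.isUnit_iff_isUnit_det _).1 hMu).ne_zero
  obtain ⟨T, hT, hTM⟩ := lift_GL ρ hρ _ hMdet
  choose s hs using fun i : Fin r => (hρ (ρ (G i.succ 0)))
  let S : Matrix (Fin (r + 1)) (Fin (r + 1)) L := Matrix.of fun i j =>
    Fin.cases (motive := fun _ => L) (if j = 0 then 1 else 0) (fun i' =>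
      Fin.cases (motive := fun _ => L) (s i') (fun j' => T i' j') j) i
  have hS0 : ∀ j, S 0 j = if j = 0 then 1 else 0 := fun j => rfl
  have hSs : S.submatrix Fin.succ Fin.succ = T := rfl
  have hSu : IsUnit S := by
    rw [Matrix.isUnit_iff_isUnit_det, hdet S hS0, hSs]
    exact (Matrix.isUnit_iff_isUnit_det _).1 hT
  have hSρ : S.map ρ = G.map ρ := by
    ext i j
    refine Fin.cases ?_ (fun i' => ?_) i
    · change ρ (S 0 j) = ρ (G 0 j)
      rw [hS0, h0]; split_ifs <;> simp
    · refine Fin.cases ?_ (fun j' => ?_) j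
      · exact (hs i').1
      · exact congrFun (congrFun hTM i') j'
  clear_value S
  obtain ⟨S, rfl⟩ := hSu
  have hSG : (S : Matrix (Fin (r + 1)) (Fin (r + 1)) L) *
      ((↑S⁻¹ : Matrix (Fin (r + 1)) (Fin (r + 1)) L) * G) = G := by
    rw [← mul_assoc, S.mul_inv, one_mul]
  refine ⟨(↑S⁻¹ : Matrix (Fin (r + 1)) (Fin (r + 1)) L) * G, S⁻¹.isUnit.mul hG, ?_, ?_⟩
  · conv_rhs => rw [← hSG]
    ext j
    rw [Matrix.mul_apply (M := (S : Matrix (Fin (r + 1)) (Fin (r + 1)) L))]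
    simp [hS0]
  · have := congrArg (fun M : Matrix (Fin (r + 1)) (Fin (r + 1)) L => M.map ρ) hSG
    rw [Matrix.map_mul, ← hSρ] at this
    have hu : IsUnit ((S : Matrix (Fin (r + 1)) (Fin (r + 1)) L).map ρ) :=
      S.isUnit.map ρ.mapMatrix
    exact hu.mul_left_cancel (this.trans (mul_one _).symm)

lemma smul_mul_L {A : Type} [CommRing A] (a : A) (x y : HahnSeries ℤ A) :
    (a • x) * y = a • (x * y) := by
  rw [← HahnSeries.C_mul_eq_smul, ← HahnSeries.C_mul_eq_smul, mul_assoc]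

/-- The map `u ↦ polynomial part of u N`. -/
noncomputable def phiN {A : Type} [CommRing A] {n : ℕ}
    (N : Matrix (Fin n) (Fin n) (HahnSeries ℤ A)) :
    (Fin n → A[X]) →ₗ[A] (Fin n → A[X]) where
  toFun u := fun i => polyPart A (Matrix.vecMul (fun k => iotaL A (u k)) N i)
  map_add' u u' := by
    ext1 i
    simp only [Matrix.vecMul, dotProduct, Pi.add_apply, map_add, add_mul, Finset.sum_add_distrib]
  map_smul' a u := by
    ext1 i
    simp only [Matrix.vecMul, dotProduct, Pi.smul_apply, iotaL_smul, RingHom.id_apply,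
      smul_mul_L, ← Finset.smul_sum, map_smul]

lemma phiN_apply {A : Type} [CommRing A] {n : ℕ}
    (N : Matrix (Fin n) (Fin n) (HahnSeries ℤ A)) (u : Fin n → A[X]) (i : Fin n) :
    phiN N u i = polyPart A (Matrix.vecMul (fun k => iotaL A (u k)) N i) := rfl

lemma row_eq_sum {A : Type} [CommRing A] {n : ℕ} (u : Fin n → A[X]) (D : ℕ)
    (h : ∀ i j, D < j → (u i).coeff j = 0) :
    u = ∑ i, ∑ j ∈ Finset.range (D + 1), (u i).coeff j • (Pi.single i (X ^ j) : Fin n → A[X]) := by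
  ext k m
  simp only [Finset.sum_apply, Pi.smul_apply, finsetSum_coeff]
  rw [Finset.sum_eq_single k]
  · simp only [Pi.single_eq_same, coeff_smul, coeff_X_pow, smul_eq_mul, mul_ite, mul_one, mul_zero,
      Finset.sum_ite_eq, Finset.mem_range]
    split_ifs with hm
    · rfl
    · exact h k m (by omega)
  · intro b _ hb
    refine Finset.sum_eq_zero fun j _ => ?_
    rw [Pi.single_eq_of_ne hb.symm]; simp
  · simp

lemma phiN_residue {A : Type} [CommRing A] [IsLocalRing A] {n : ℕ}
    (N : Matrix (Fin n) (Fin n) (HahnSeries ℤ A))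
    (hN : N.map (mapL (IsLocalRing.residue A)) = 1) (u : Fin n → A[X]) (i : Fin n) (j : ℕ) :
    IsLocalRing.residue A ((phiN N u i).coeff j) = IsLocalRing.residue A ((u i).coeff j) := by
  have h1 : mapL (IsLocalRing.residue A) (Matrix.vecMul (fun k => iotaL A (u k)) N i)
      = mapL (IsLocalRing.residue A) (iotaL A (u i)) := by
    simp only [Matrix.vecMul, dotProduct, map_sum, map_mul]
    have h2 : ∀ k, mapL (IsLocalRing.residue A) (N k i)
        = (1 : Matrix (Fin n) (Fin n) (HahnSeries ℤ (IsLocalRing.ResidueField A))) k i := by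
      intro k; rw [← hN]; rfl
    simp only [h2, Matrix.one_apply]
    simp
  rw [phiN_apply, polyPart_coeff, ← mapL_coeff, h1, mapL_coeff, iotaL_coeff, if_pos (by omega)]
  simp

lemma phiN_surjective {A : Type} [CommRing A] [IsLocalRing A] {n : ℕ}
    (N : Matrix (Fin n) (Fin n) (HahnSeries ℤ A)) (hu : IsUnit N)
    (hN : N.map (mapL (IsLocalRing.residue A)) = 1) : Function.Surjective (phiN N) := by
  classical
  let m := IsLocalRing.maximalIdeal A
  obtain ⟨N, rfl⟩ := hu
  let D : ℕ := ∑ i, ∑ j, ((N : Matrix (Fin n) (Fin n) (HahnSeries ℤ A)) i j).order.natAbs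
  have hD : ∀ i j, ∀ k < -(D : ℤ),
      ((N : Matrix (Fin n) (Fin n) (HahnSeries ℤ A)) i j).coeff k = 0 := by
    intro i j k hk
    apply HahnSeries.coeff_eq_zero_of_lt_order
    have h1 : ((N : Matrix (Fin n) (Fin n) (HahnSeries ℤ A)) i j).order.natAbs ≤ D :=
      (Finset.single_le_sum (f := fun j =>
        ((N : Matrix (Fin n) (Fin n) (HahnSeries ℤ A)) i j).order.natAbs)
        (fun _ _ => Nat.zero_le _) (Finset.mem_univ j)).trans
      (Finset.single_le_sum (f := fun i => ∑ j,
        ((N : Matrix (Fin n) (Fin n) (HahnSeries ℤ A)) i j).order.natAbs)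
        (fun _ _ => Nat.zero_le _) (Finset.mem_univ i))
    omega
  let W : Submodule A (Fin n → A[X]) := Submodule.span A
    (Set.range fun p : Fin n × Fin (D + 1) => (Pi.single p.1 (X ^ (p.2 : ℕ)) : Fin n → A[X]))
  have hWfg : W.FG := Submodule.fg_span (Set.finite_range _)
  have htop : (⊤ : Submodule A (Fin n → A[X])) ≤ LinearMap.range (phiN ↑N) ⊔ W := by
    intro u _
    let x : Fin n → HahnSeries ℤ A := Matrix.vecMul (fun k => iotaL A (u k)) ↑N⁻¹
    let α : Fin n → A[X] := fun i => polyPart A (x i)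
    let β : Fin n → HahnSeries ℤ A := fun i => x i - iotaL A (α i)
    have hβ : ∀ i, ∀ k < (1 : ℤ), (β i).coeff k = 0 := by
      intro i
      have : IsPosL (β i) := by
        rw [isPosL_iff]; simp only [β, α, map_sub, polyPart_iotaL, sub_self]
      intro k hk; exact this k (by omega)
    have hsplit : ∀ i, u i - phiN ↑N α i = polyPart A (Matrix.vecMul β ↑N i) := by
      intro i
      have h1 : β = x - fun k => iotaL A (α k) := rfl
      have h2 : Matrix.vecMul x (N : Matrix (Fin n) (Fin n) (HahnSeries ℤ A))
          = fun k => iotaL A (u k) := by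
        simp only [x, Matrix.vecMul_vecMul, N.inv_mul, Matrix.vecMul_one]
      rw [h1, Matrix.sub_vecMul, h2, Pi.sub_apply, map_sub, polyPart_iotaL, phiN_apply]
    rw [show u = phiN ↑N α + (u - phiN ↑N α) by abel]
    refine Submodule.add_mem_sup ⟨α, rfl⟩ ?_
    rw [row_eq_sum (u - phiN ↑N α) D]
    · refine Submodule.sum_mem _ fun i _ => Submodule.sum_mem _ fun j hj =>
        Submodule.smul_mem _ _ (Submodule.subset_span ?_)
      exact ⟨(i, ⟨j, Finset.mem_range.1 hj⟩), rfl⟩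
    · intro i j hj
      rw [Pi.sub_apply, hsplit, polyPart_coeff]
      simp only [Matrix.vecMul, dotProduct, HahnSeries.coeff_sum]
      refine Finset.sum_eq_zero fun k _ => ?_
      exact coeff_mul_zero_of_bounds (hβ k) (hD k i) _ (by omega)
  have hm : (⊤ : Submodule A (Fin n → A[X])) ≤ LinearMap.range (phiN ↑N) ⊔ m • ⊤ := by
    intro u _
    rw [show u = phiN ↑N u + (u - phiN ↑N u) by abel]
    refine Submodule.add_mem_sup ⟨u, rfl⟩ ?_
    rw [row_eq_sum (u - phiN ↑N u) (∑ i, ((u - phiN ↑N u) i).natDegree)]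
    · refine Submodule.sum_mem _ fun i _ => Submodule.sum_mem _ fun j hj =>
        Submodule.smul_mem_smul ?_ trivial
      rw [← IsLocalRing.residue_eq_zero_iff, Pi.sub_apply, coeff_sub, map_sub,
        phiN_residue _ hN, sub_self]
    · intro i j hj
      apply coeff_eq_zero_of_natDegree_lt
      exact (Finset.single_le_sum (f := fun i => ((u - phiN ↑N u) i).natDegree)
        (fun _ _ => Nat.zero_le _) (Finset.mem_univ i)).trans_lt hj
  have hm2 : m • (⊤ : Submodule A (Fin n → A[X])) ≤ LinearMap.range (phiN ↑N) ⊔ m • W := by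
    refine (Submodule.smul_mono le_rfl htop).trans ?_
    rw [Submodule.smul_sup]
    exact sup_le_sup_right Submodule.smul_le_right _
  have hW : W ≤ LinearMap.range (phiN ↑N) := by
    refine Submodule.le_of_le_smul_of_le_jacobson_bot (I := m) hWfg
      (IsLocalRing.maximalIdeal_le_jacobson _) ?_
    exact (le_top.trans hm).trans (sup_le le_sup_left hm2)
  rw [← LinearMap.range_eq_top, eq_top_iff]
  exact htop.trans (sup_le le_rfl hW)

lemma mapL_iotaL {A B : Type} [CommRing A] [CommRing B] (f : A →+* B) (p : A[X]) :
    mapL f (iotaL A p) = iotaL B (p.map f) := by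
  ext n
  rw [mapL_coeff, iotaL_coeff, iotaL_coeff, coeff_map]
  split_ifs <;> simp

/-- Local Horrocks type statement used for the twisted row. -/
lemma horrocks_twisted {A : Type} [CommRing A] [IsLocalRing A] {r : ℕ}
    (v w : Fin (r + 1) → A[X]) (hvw : ∑ i, v i * w i = 1)
    (hres : ∀ i, (v i).map (IsLocalRing.residue A) = if i = 0 then 1 else 0)
    (i1 : Fin (r + 1)) (e : ℕ) (he : ∀ i, (w i).natDegree ≤ e)
    (hc : IsCompletable (fun i => X ^ (e + 2) * v i + (if i = 0 then 1 else 0)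
      + (if i = i1 then X else 0) : Fin (r + 1) → A[X])) : IsCompletable v := by
  classical
  let ι := iotaL A
  let ρ := mapL (IsLocalRing.residue A)
  obtain ⟨G0, hG0, i0, hG0i⟩ := hc
  let G := G0.submatrix (Equiv.swap 0 i0) (Equiv.refl _)
  have hG : IsUnit G := (Matrix.isUnit_submatrix_equiv (A := G0) (Equiv.swap 0 i0) (Equiv.refl _)).2 hG0
  have hG0' : ∀ j, G 0 j = X ^ (e + 2) * v j + (if j = 0 then 1 else 0)
      + (if j = i1 then X else 0) := by
    intro j
    have : G 0 j = G0 i0 j := by simp [G]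
    rw [this, hG0i]
  let ιv : Fin (r + 1) → HahnSeries ℤ A := fun i => ι (v i)
  let ιw : Fin (r + 1) → HahnSeries ℤ A := fun i => ι (w i)
  let δ : Fin (r + 1) → HahnSeries ℤ A := fun j => (if j = 0 then HahnSeries.single ((e : ℤ) + 2) 1 else 0)
    + (if j = i1 then HahnSeries.single ((e : ℤ) + 1) 1 else 0)
  let Q : Matrix (Fin (r + 1)) (Fin (r + 1)) (HahnSeries ℤ A) := 1 + Matrix.vecMulVec ιw δ
  have hQ : IsUnit Q := by
    refine isUnit_of_isPosL Q fun i j => ?_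
    have h1 : (Q - 1) i j = ιw i * δ j := by simp [Q, Matrix.vecMulVec_apply]
    rw [h1]
    intro n hn
    refine coeff_mul_zero_of_bounds (a := -(e : ℤ)) (b := (e : ℤ) + 1) ?_ ?_ n (by omega)
    · intro k hk
      simp only [ιw, ι]
      rw [iotaL_coeff]
      split_ifs
      · apply coeff_eq_zero_of_natDegree_lt
        have := he i
        omega
      · rfl
    · intro k hk
      simp only [δ, HahnSeries.coeff_add]
      have h2 : ∀ (P : Prop) [Decidable P] (a : ℤ), (e : ℤ) + 1 ≤ a →
          (if P then HahnSeries.single a (1 : A) else 0).coeff k = 0 := by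
        intro P _ a ha
        split_ifs
        · rw [HahnSeries.coeff_single_of_ne (by omega)]
        · simp
      rw [h2 _ _ (by omega), h2 _ _ (by omega), add_zero]
  have hdot : dotProduct ιv ιw = 1 := by
    simp only [dotProduct, ιv, ιw, ← map_mul, ← map_sum, hvw, map_one]
  have hvQ : Matrix.vecMul ιv Q = ιv + δ := by
    simp only [Q]
    rw [Matrix.vecMul_add, Matrix.vecMul_one, Matrix.vecMul_vecMulVec, hdot, one_smul]
  let E : Matrix (Fin (r + 1)) (Fin (r + 1)) (HahnSeries ℤ A) :=
    Matrix.diagonal fun i => if i = 0 then HahnSeries.single ((e : ℤ) + 2) 1 else 1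
  have hE : IsUnit E := by
    rw [Matrix.isUnit_diagonal, Pi.isUnit_iff]
    intro i
    split_ifs
    · refine IsUnit.of_mul_eq_one (HahnSeries.single (-((e : ℤ) + 2)) 1) ?_
      rw [HahnSeries.single_mul_single, add_neg_cancel, mul_one]; rfl
    · exact isUnit_one
  have hιG : IsUnit (G.map ι) := hG.map ι.mapMatrix
  have hιX : ∀ j : ℕ, ι (X ^ j) = HahnSeries.single (-(j : ℤ)) 1 := by
    intro j
    rw [map_pow, ← single_neg_pow]; congr 1; simp [ι, iotaL]
  have hιX1 : ι X = HahnSeries.single (-1 : ℤ) 1 := by simpa using hιX 1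
  have hEG : (E * G.map ι) 0 = ιv + δ := by
    ext1 j
    have h1 : (E * G.map ι) 0 j = HahnSeries.single ((e : ℤ) + 2) 1 * ι (G 0 j) := by
      rw [Matrix.diagonal_mul, if_pos rfl, Matrix.map_apply]
    rw [h1, hG0', map_add, map_add, map_mul, hιX, mul_add, mul_add, ← mul_assoc,
      HahnSeries.single_mul_single, Pi.add_apply,
      show (e : ℤ) + 2 + -((e + 2 : ℕ) : ℤ) = 0 by push_cast; ring, mul_one, add_assoc]
    refine congrArg₂ (· + ·) (one_mul _) (congrArg₂ (· + ·) ?_ ?_)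
    · split_ifs <;> simp
    · split_ifs
      · rw [hιX1, HahnSeries.single_mul_single, mul_one,
          show (e : ℤ) + 2 + -1 = e + 1 by ring]
      · simp
  obtain ⟨Q', hQ'⟩ := hQ
  let Cm : Matrix (Fin (r + 1)) (Fin (r + 1)) (HahnSeries ℤ A) := E * G.map ι * (↑Q'⁻¹ : Matrix (Fin (r + 1)) (Fin (r + 1)) (HahnSeries ℤ A))
  have hCm : IsUnit Cm := (hE.mul hιG).mul Q'⁻¹.isUnit
  have hCm0 : Cm 0 = ιv := by
    have h1 : Cm 0 = Matrix.vecMul ((E * G.map ι) 0) (↑Q'⁻¹ : Matrix (Fin (r + 1)) (Fin (r + 1)) (HahnSeries ℤ A)) :=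
      Matrix.mul_apply_eq_vecMul _ _ _
    rw [h1, hEG, ← hvQ, ← hQ', Matrix.vecMul_vecMul, Q'.mul_inv, Matrix.vecMul_one]
  obtain ⟨G', hG', hG'0, hG'ρ⟩ := adjust_row ρ mapL_lift Cm hCm (by
    intro j
    rw [hCm0]
    simp only [ρ, ιv, ι]
    rw [mapL_iotaL, hres]
    split_ifs <;> simp)
  rw [hCm0] at hG'0
  obtain ⟨U, rfl⟩ := hG'
  let N : Matrix (Fin (r + 1)) (Fin (r + 1)) (HahnSeries ℤ A) := ↑U⁻¹
  have hN : IsUnit N := U⁻¹.isUnit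
  have hNρ : N.map ρ = 1 := by
    have h1 : (N * (U : Matrix (Fin (r + 1)) (Fin (r + 1)) (HahnSeries ℤ A))).map ρ = 1 := by
      simp only [N, U.inv_mul]
      exact map_one ρ.mapMatrix
    rwa [Matrix.map_mul, hG'ρ, mul_one] at h1
  have hone : ∀ i j, polyPart A ((1 : Matrix (Fin (r + 1)) (Fin (r + 1)) (HahnSeries ℤ A)) i j)
      = (1 : Matrix (Fin (r + 1)) (Fin (r + 1)) A[X]) i j := by
    intro i j
    have : (1 : Matrix (Fin (r + 1)) (Fin (r + 1)) (HahnSeries ℤ A)) i j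
        = ι ((1 : Matrix (Fin (r + 1)) (Fin (r + 1)) A[X]) i j) := by
      simp only [Matrix.one_apply]; split_ifs <;> simp
    rw [this]; exact polyPart_iotaL _
  choose b hb using fun i => phiN_surjective N hN hNρ
    ((1 : Matrix (Fin (r + 1)) (Fin (r + 1)) A[X]) i)
  let a : Matrix (Fin (r + 1)) (Fin (r + 1)) A[X] := Matrix.of fun i => if i = 0 then v else b i
  have ha0 : a 0 = v := rfl
  have ha : ∀ i, phiN N (a i) = (1 : Matrix (Fin (r + 1)) (Fin (r + 1)) A[X]) i := by
    intro i
    by_cases hi : i = 0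
    · subst hi
      rw [ha0]
      ext1 j
      rw [phiN_apply, ← hone]
      congr 1
      have h1 : Matrix.vecMul ((U : Matrix (Fin (r + 1)) (Fin (r + 1)) (HahnSeries ℤ A)) 0) N
          = (1 : Matrix (Fin (r + 1)) (Fin (r + 1)) (HahnSeries ℤ A)) 0 := by
        rw [← Matrix.mul_apply_eq_vecMul]; simp only [N, U.mul_inv]
      rw [hG'0] at h1
      exact congrFun h1 j
    · have : a i = b i := if_neg hi
      rw [this, hb]
  have hbu : IsUnit (a.map ι * N) := by
    refine isUnit_of_isPosL _ fun i j => ?_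
    rw [isPosL_iff, Matrix.sub_apply, map_sub, hone, ← ha i, phiN_apply,
      Matrix.mul_apply_eq_vecMul]
    exact sub_self _
  have hau : IsUnit (a.map ι) := by
    have h1 := hbu.mul U.isUnit
    rwa [mul_assoc, U.inv_mul, mul_one] at h1
  have haρ : (a.map ι).map ρ = 1 := by
    ext1 i j
    change mapL _ (iotaL A (a i j)) = _
    have h1 : (a i j).map (IsLocalRing.residue A) = if i = j then 1 else 0 := by
      ext k
      rw [coeff_map, ← phiN_residue N hNρ (a i) j k, ha, Matrix.one_apply]
      split_ifs
      · rw [coeff_one, coeff_one]; split_ifs <;> simp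
      · simp
    rw [mapL_iotaL, h1, Matrix.one_apply]
    split_ifs <;> simp
  choose B hB using fun i => phiN_surjective _ hau haρ
    ((1 : Matrix (Fin (r + 1)) (Fin (r + 1)) A[X]) i)
  have hBa : Matrix.of B * a = 1 := by
    ext1 i j
    have h1 := congrFun (hB i) j
    rw [← h1, phiN_apply, Matrix.mul_apply_eq_vecMul]
    have h2 : Matrix.vecMul (fun k => iotaL A (B i k)) (a.map ι) j
        = iotaL A (Matrix.vecMul (B i) a j) := by
      simp only [Matrix.vecMul, dotProduct, map_sum, map_mul, Matrix.map_apply, ι]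
    rw [h2, polyPart_iotaL]; rfl
  exact ⟨a, ⟨⟨_, _, mul_eq_one_comm.1 hBa, hBa⟩, rfl⟩, 0, ha0⟩

/-- **Theorem.** Let `R` be a commutative ring and `r ≥ 2`.  If for all `k, n ∈ ℕ` every
unimodular row over `B^R_{r,k,n}[t]` which equals `(1, 0, …, 0)` at `t = 0` is completable,
then for every commutative local `R`-algebra `A`, every unimodular row of length `r+1` over
`A[t]` is completable. -/
theorem local_completable_of_testRings (R : Type) [CommRing R] (r : ℕ) (hr : 2 ≤ r)
    (h : ∀ k n : ℕ, ∀ a : Fin (r + 1) → Polynomial (BFin R r k n), IsUnimodular a →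
      (∀ i, (a i).eval 0 = if i = 0 then 1 else 0) → IsCompletable a) :
    ∀ (A : Type) [CommRing A] [IsLocalRing A] [Algebra R A],
      ∀ v : Fin (r + 1) → Polynomial A, IsUnimodular v → IsCompletable v := by
  intro A _ _ _ v hv
  obtain ⟨M, hM, hres⟩ := exists_reduce v hv
  apply completable_of_mul hM
  obtain ⟨M, rfl⟩ := hM
  obtain ⟨w, hw⟩ := (unimodular_iff v).1 hv
  let w' : Fin (r + 1) → A[X] :=
    Matrix.mulVec (↑M⁻¹ : Matrix (Fin (r + 1)) (Fin (r + 1)) A[X]) w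
  have hvw : ∑ i, Matrix.vecMul v (M : Matrix (Fin (r + 1)) (Fin (r + 1)) A[X]) i * w' i = 1 := by
    have : dotProduct (Matrix.vecMul v ↑M) w' = 1 := by
      simp only [w']
      rw [← Matrix.dotProduct_mulVec, Matrix.mulVec_mulVec]; simpa [dotProduct] using hw
    simpa [dotProduct] using this
  have hi1 : (⟨1, by omega⟩ : Fin (r + 1)) ≠ 0 := by
    intro h; simpa using congrArg Fin.val h
  have he : ∀ i, (w' i).natDegree ≤ ∑ i, (w' i).natDegree := fun i =>
    Finset.single_le_sum (f := fun i => (w' i).natDegree)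
      (fun _ _ => Nat.zero_le _) (Finset.mem_univ i)
  refine horrocks_twisted _ w' hvw hres ⟨1, by omega⟩ _ he ?_
  refine completable_twisted R r _ hi1 h A _ w' hvw ?_ _ he
  intro j
  rw [← IsLocalRing.residue_eq_zero_iff, ← coeff_map, hres, if_neg hi1, coeff_zero]
end

section
/- Let R be an integral domain. Then the polynomial xy + zw is irreducible in the polynomial ring R[x, y, z, w]. -/
/-- **Lemma.** For an integral domain `R`, the polynomial `xy + zw` is irreducible in
`R[x, y, z, w]`. -/
theorem irreducible_xy_add_zw (R : Type) [CommRing R] [IsDomain R] :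
    Irreducible (MvPolynomial.X 0 * MvPolynomial.X 1 + MvPolynomial.X 2 * MvPolynomial.X 3 :
      MvPolynomial (Fin 4) R) := by
  have hp : Prime (MvPolynomial.X 0 : MvPolynomial (Fin 4) R) := MvPolynomial.X_prime
  apply MvPolynomial.irreducible_mul_X_add
  · exact MvPolynomial.X_ne_zero _
  · simp [MvPolynomial.vars_X]
  · intro h
    have := MvPolynomial.vars_mul _ _ h
    simp [MvPolynomial.vars_X] at this
  · rw [hp.irreducible.isRelPrime_iff_not_dvd]
    intro h
    rcases hp.dvd_or_dvd h with h | h <;> simp [MvPolynomial.X_dvd_X] at h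
end

section
/- Let R be a unique factorization domain and S a set of variables. Let f₁, …, f_m ∈ R[S] be homogeneous polynomials of degree 2 such that the quotient ring B = R[S]/(f₁, …, f_m) is an integral domain, and let g ∈ R[S] be a homogeneous polynomial of degree 2. Assume that there exists a monomial whose coefficient in g is a unit of R and whose coefficient in each f_i (i = 1, …, m) is 0. Then the image ḡ of g in B is irreducible in each of the following cases: (1) there exists a variable reduction φ : S → {c₀, d₀, e₀, f₀} ∪ {0} with φ_*(g) = c₀d₀ + e₀f₀ and φ_*(f_i) = 0 for all i; (2) there exists a variable reduction φ : S → {c₀, d₀, e₀, f₀, c_ℓ, d_ℓ, e_ℓ, f_ℓ} ∪ {0} with φ_*(g) = c₀d_ℓ + c_ℓd₀ + e₀f_ℓ + e_ℓf₀ and φ_*(f_i) = 0 for all i; (3) there exists a variable reduction φ : S → {c₀, d₀, e₀, f₀, c_ℓ, d_ℓ, e_ℓ, f_ℓ} ∪ {0} and an index j ∈ {1, …, m} with φ_*(g) = c₀d_ℓ + c_ℓd₀ + e₀f_ℓ + e_ℓf₀, φ_*(f_i) = 0 for all i ≠ j, and φ_*(f_j) = c_ℓd_ℓ + e_ℓf_ℓ.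 -/
open MvPolynomial

/-- The `R`-algebra homomorphism `R[S] → R[T]` induced by a variable reduction
`φ : S → T ∪ {0}`: each variable `s` is sent to the variable `φ s`, or to `0`. -/
noncomputable def varRed {R : Type} [CommRing R] {S T : Type} (φ : S → Option T) :
    MvPolynomial S R →ₐ[R] MvPolynomial T R :=
  MvPolynomial.aeval (fun s => (φ s).elim 0 MvPolynomial.X)

theorem vr_hc_mul {R : Type} [CommRing R] {S : Type} (q f : MvPolynomial S R)
    (hf : f.IsHomogeneous 2) : homogeneousComponent 2 (q * f) = C (coeff 0 q) * f := by
  classical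
  induction q using MvPolynomial.induction_on' with
  | monomial d a =>
    have h : (monomial d a * f).IsHomogeneous (d.degree + 2) :=
      (isHomogeneous_monomial a rfl).mul hf
    rw [homogeneousComponent_of_mem h]
    by_cases hd : d = 0
    · subst hd
      rw [monomial_zero', coeff_C]
      simp
    · have : d.degree ≠ 0 := by simpa [Finsupp.degree_eq_zero_iff] using hd
      rw [if_neg (by omega), coeff_monomial, if_neg hd]
      simp
  | add p q hp hq => simp [add_mul, hp, hq]

theorem vr_mem {R : Type} [CommRing R] {S : Type} {m : ℕ} {f : Fin m → MvPolynomial S R}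
    (hf : ∀ i, (f i).IsHomogeneous 2) {P : MvPolynomial S R} (hP : P.IsHomogeneous 2)
    (hmem : P ∈ Ideal.span (Set.range f)) : ∃ r : Fin m → R, P = ∑ i, C (r i) * f i := by
  obtain ⟨c, hc⟩ := Ideal.mem_span_range_iff_exists_fun.1 hmem
  refine ⟨fun i => coeff 0 (c i), ?_⟩
  rw [← homogeneousComponent_eq_self hP, ← hc, map_sum]
  exact Finset.sum_congr rfl fun i _ => vr_hc_mul _ _ (hf i)

/-- scaling of the variables by `t` -/
noncomputable def vrScale {R : Type} [CommRing R] {S : Type} (I : Ideal (MvPolynomial S R)) :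
    MvPolynomial S R →ₐ[R] Polynomial (MvPolynomial S R ⧸ I) :=
  aeval fun s => Polynomial.C (Ideal.Quotient.mk I (X s)) * Polynomial.X

theorem vr_prod {B S : Type} [CommRing B] (s : Finset S) (a : S → B) (d : S → ℕ) :
    ∏ x ∈ s, (Polynomial.C (a x) * Polynomial.X) ^ d x =
      (∏ x ∈ s, Polynomial.C (a x) ^ d x) * Polynomial.X ^ ∑ x ∈ s, d x := by
  simp only [mul_pow, Finset.prod_mul_distrib, Finset.prod_pow_eq_pow_sum]

theorem vrScale_hom {R : Type} [CommRing R] {S : Type} (I : Ideal (MvPolynomial S R))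
    {P : MvPolynomial S R} {n : ℕ} (hP : P.IsHomogeneous n) :
    vrScale I P = Polynomial.C (Ideal.Quotient.mk I P) * Polynomial.X ^ n := by
  have key : ∀ (d : S →₀ ℕ) (r : R), vrScale I (monomial d r) =
      Polynomial.C (Ideal.Quotient.mk I (monomial d r)) * Polynomial.X ^ d.degree := by
    intro d r
    rw [vrScale, aeval_monomial, monomial_eq]
    simp only [Finsupp.prod, map_mul, map_prod, map_pow, Finsupp.degree_apply, mul_assoc]
    exact congrArg _ (vr_prod (B := MvPolynomial S R ⧸ I) d.support
      (fun x => Ideal.Quotient.mk I (X x)) d)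
  conv_lhs => rw [P.as_sum]
  conv_rhs => rw [P.as_sum]
  rw [map_sum, map_sum, map_sum, Finset.sum_mul]
  refine Finset.sum_congr rfl fun d hd => ?_
  rw [key, hP.degree_eq_sum_deg_support hd]
  rfl

theorem vrScale_coeff {R : Type} [CommRing R] {S : Type} (I : Ideal (MvPolynomial S R))
    (P : MvPolynomial S R) (n : ℕ) :
    (vrScale I P).coeff n = Ideal.Quotient.mk I (homogeneousComponent n P) := by
  conv_lhs => rw [← sum_homogeneousComponent P]
  rw [map_sum, Polynomial.finsetSum_coeff]
  simp_rw [vrScale_hom I (homogeneousComponent_isHomogeneous _ P), Polynomial.coeff_C_mul_X_pow]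
  rw [Finset.sum_ite_eq]
  split_ifs with h
  · rfl
  · rw [homogeneousComponent_eq_zero n P (by simpa using h), map_zero]

theorem vrScale_eval {R : Type} [CommRing R] {S : Type} (I : Ideal (MvPolynomial S R))
    (P : MvPolynomial S R) :
    (vrScale I P).eval 1 = Ideal.Quotient.mk I P := by
  conv_lhs => rw [← sum_homogeneousComponent P]
  conv_rhs => rw [← sum_homogeneousComponent P]
  rw [map_sum, map_sum, Polynomial.eval_finsetSum]
  simp [vrScale_hom I (homogeneousComponent_isHomogeneous _ P)]

theorem vrScale_ker {R : Type} [CommRing R] {S : Type} {m : ℕ} {f : Fin m → MvPolynomial S R}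
    (hf : ∀ i, (f i).IsHomogeneous 2) {P : MvPolynomial S R}
    (h : P ∈ Ideal.span (Set.range f)) : vrScale (Ideal.span (Set.range f)) P = 0 := by
  have : Ideal.span (Set.range f) ≤ RingHom.ker (vrScale (Ideal.span (Set.range f))) := by
    rw [Ideal.span_le]
    rintro _ ⟨i, rfl⟩
    have h0 : Ideal.Quotient.mk (Ideal.span (Set.range f)) (f i) = 0 :=
      Ideal.Quotient.eq_zero_iff_mem.2 (Ideal.subset_span ⟨i, rfl⟩)
    simp [RingHom.mem_ker, vrScale_hom _ (hf i), h0]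
  exact this h

theorem vr_poly {B : Type} [CommRing B] [IsDomain B] {p q : Polynomial B} {c : B} (hc : c ≠ 0)
    {n : ℕ} (h : p * q = Polynomial.C c * Polynomial.X ^ n) :
    ∃ i j a b, i + j = n ∧ p = Polynomial.C a * Polynomial.X ^ i ∧
      q = Polynomial.C b * Polynomial.X ^ j := by
  obtain ⟨i, j, b, c', hij, hbc, hp, hq⟩ := mul_eq_mul_prime_pow Polynomial.prime_X h
  have hne : b * c' ≠ 0 := by rw [← hbc]; simpa using hc
  have hdeg := Polynomial.natDegree_mul (left_ne_zero_of_mul hne) (right_ne_zero_of_mul hne)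
  rw [← hbc, Polynomial.natDegree_C] at hdeg
  refine ⟨i, j, b.coeff 0, c'.coeff 0, hij, ?_, ?_⟩
  · rw [← Polynomial.eq_C_of_natDegree_eq_zero (by omega), hp]
  · rw [← Polynomial.eq_C_of_natDegree_eq_zero (by omega), hq]

theorem vr_factor {R : Type} [CommRing R] {S : Type} {m : ℕ} {f : Fin m → MvPolynomial S R}
    {g : MvPolynomial S R}
    (hf : ∀ i, (f i).IsHomogeneous 2) (hg : g.IsHomogeneous 2)
    (hdom : IsDomain (MvPolynomial S R ⧸ Ideal.span (Set.range f)))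
    (h0 : Ideal.Quotient.mk (Ideal.span (Set.range f)) g ≠ 0)
    (a b : MvPolynomial S R ⧸ Ideal.span (Set.range f))
    (hab : Ideal.Quotient.mk (Ideal.span (Set.range f)) g = a * b) :
    ∃ (i j : ℕ) (A B : MvPolynomial S R), i + j = 2 ∧ A.IsHomogeneous i ∧ B.IsHomogeneous j ∧
      Ideal.Quotient.mk _ A = a ∧ Ideal.Quotient.mk _ B = b := by
  obtain ⟨A, rfl⟩ := Ideal.Quotient.mk_surjective a
  obtain ⟨B, rfl⟩ := Ideal.Quotient.mk_surjective b
  set I := Ideal.span (Set.range f) with hI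
  have hmem : g - A * B ∈ I := by
    rw [← Ideal.Quotient.eq_zero_iff_mem, map_sub, map_mul, hab, sub_self]
  have h1 := vrScale_ker hf hmem
  rw [← hI, map_sub, map_mul, sub_eq_zero, vrScale_hom I hg] at h1
  obtain ⟨i, j, a, b, hij, ha, hb⟩ := vr_poly h0 h1.symm
  have gen : ∀ (P : MvPolynomial S R) k c,
      vrScale I P = Polynomial.C c * Polynomial.X ^ k →
      Ideal.Quotient.mk I (homogeneousComponent k P) = Ideal.Quotient.mk I P := by
    intro P k c h
    rw [← vrScale_coeff, ← vrScale_eval, h]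
    simp
  exact ⟨i, j, homogeneousComponent i A, homogeneousComponent j B, hij,
    homogeneousComponent_isHomogeneous _ _, homogeneousComponent_isHomogeneous _ _,
    gen A i a ha, gen B j b hb⟩

theorem vr_linear {R : Type} [CommRing R] {S T : Type} (φ : S → Option T) {A : MvPolynomial S R}
    (hA : A.IsHomogeneous 1) (v w : T → R) :
    eval (v + w) (varRed φ A) = eval v (varRed φ A) + eval w (varRed φ A) := by
  have : A ∈ homogeneousSubmodule S R 1 := hA
  rw [homogeneousSubmodule_one_eq_span_X] at this
  clear hA
  induction this using Submodule.span_induction with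
  | mem x h =>
    obtain ⟨s, rfl⟩ := h
    simp only [varRed, aeval_X]
    cases φ s <;> simp
  | zero => simp
  | add x y _ _ hx hy =>
    rw [map_add, map_add, map_add, map_add, hx, hy]; ring
  | smul a x _ hx =>
    rw [map_smul, smul_eval, smul_eval, smul_eval, hx]; ring

theorem vr_quad {R : Type} [CommRing R] [IsDomain R] (L M : (Fin 4 → R) → R)
    (hL : ∀ v w, L (v + w) = L v + L w) (hM : ∀ v w, M (v + w) = M v + M w)
    (h : ∀ v, v 0 * v 1 + v 2 * v 3 = L v * M v) : False := by
  have pol : ∀ v w : Fin 4 → R, L v * M w + L w * M v =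
      v 0 * w 1 + w 0 * v 1 + v 2 * w 3 + w 2 * v 3 := by
    intro v w
    have h1 := h (v + w)
    rw [hL, hM] at h1
    simp only [Pi.add_apply] at h1
    linear_combination h v + h w - h1
  have h00 := h ![1, 0, 0, 0]
  have h01 := pol ![1, 0, 0, 0] ![0, 1, 0, 0]
  have h02 := pol ![1, 0, 0, 0] ![0, 0, 1, 0]
  have h03 := pol ![1, 0, 0, 0] ![0, 0, 0, 1]
  have h23 := pol ![0, 0, 1, 0] ![0, 0, 0, 1]
  simp at h00 h01 h02 h03 h23
  rcases h00 with h00 | h00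
  · rw [h00] at h01 h02 h03
    have hne : M ![1, 0, 0, 0] ≠ 0 := by
      intro h; rw [h] at h01; simp at h01
    simp [hne] at h02 h03
    rw [h02, h03] at h23
    simp at h23
  · rw [h00] at h01 h02 h03
    have hne : L ![1, 0, 0, 0] ≠ 0 := by
      intro h; rw [h] at h01; simp at h01
    simp [hne] at h02 h03
    rw [h02, h03] at h23
    simp at h23

/-- **Lemma (irreducibility criterion).**  Let `R` be a UFD, `f₁, …, f_m ∈ R[S]` homogeneous
of degree 2 with `B = R[S]/(f₁, …, f_m)` a domain, and `g ∈ R[S]` homogeneous of degree 2.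
Assume some monomial has unit coefficient in `g` and coefficient `0` in every `f_i`.  Then
`ḡ ∈ B` is irreducible provided one of the following variable reductions exists (variables
`c₀, d₀, e₀, f₀` are encoded as `0, 1, 2, 3 : Fin 4` resp. `Fin 8`, and
`c_ℓ, d_ℓ, e_ℓ, f_ℓ` as `4, 5, 6, 7 : Fin 8`):
(1) `φ : S → Fin 4 ∪ {0}` with `φ_* g = c₀d₀ + e₀f₀` and `φ_* f_i = 0` for all `i`;
(2) `φ : S → Fin 8 ∪ {0}` with `φ_* g = c₀d_ℓ + c_ℓd₀ + e₀f_ℓ + e_ℓf₀` and `φ_* f_i = 0`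
    for all `i`;
(3) `φ : S → Fin 8 ∪ {0}` and `j` with `φ_* g = c₀d_ℓ + c_ℓd₀ + e₀f_ℓ + e_ℓf₀`,
    `φ_* f_i = 0` for `i ≠ j`, and `φ_* f_j = c_ℓd_ℓ + e_ℓf_ℓ`. -/
theorem irreducible_of_variable_reduction (R : Type) [CommRing R] [IsDomain R]
    [UniqueFactorizationMonoid R] (S : Type) (m : ℕ)
    (f : Fin m → MvPolynomial S R) (g : MvPolynomial S R)
    (hf : ∀ i, (f i).IsHomogeneous 2) (hg : g.IsHomogeneous 2)
    (hdom : IsDomain (MvPolynomial S R ⧸ Ideal.span (Set.range f)))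
    (hmono : ∃ d : S →₀ ℕ, IsUnit (g.coeff d) ∧ ∀ i, (f i).coeff d = 0)
    (hcase :
      (∃ φ : S → Option (Fin 4),
        varRed φ g = X 0 * X 1 + X 2 * X 3 ∧ ∀ i, varRed φ (f i) = 0) ∨
      (∃ φ : S → Option (Fin 8),
        varRed φ g = X 0 * X 5 + X 4 * X 1 + X 2 * X 7 + X 6 * X 3 ∧
        ∀ i, varRed φ (f i) = 0) ∨
      (∃ (φ : S → Option (Fin 8)) (j : Fin m),
        varRed φ g = X 0 * X 5 + X 4 * X 1 + X 2 * X 7 + X 6 * X 3 ∧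
        (∀ i, i ≠ j → varRed φ (f i) = 0) ∧
        varRed φ (f j) = X 4 * X 5 + X 6 * X 7)) :
    Irreducible (Ideal.Quotient.mk (Ideal.span (Set.range f)) g) := by
  obtain ⟨d, hd, hfd⟩ := hmono
  have hcoef : ∀ P : MvPolynomial S R, P.IsHomogeneous 2 → P ∈ Ideal.span (Set.range f) →
      P.coeff d = 0 := by
    intro P hP hmem
    obtain ⟨r, rfl⟩ := vr_mem hf hP hmem
    simp [coeff_sum, coeff_C_mul, hfd]
  have h0 : Ideal.Quotient.mk (Ideal.span (Set.range f)) g ≠ 0 := by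
    intro h
    rw [hcoef g hg (Ideal.Quotient.eq_zero_iff_mem.1 h)] at hd
    exact not_isUnit_zero hd
  have hunit : ∀ A B : MvPolynomial S R, A.IsHomogeneous 0 → B.IsHomogeneous 2 →
      g - A * B ∈ Ideal.span (Set.range f) → IsUnit A := by
    intro A B hA hB hmem
    have hhom : (A * B).IsHomogeneous 2 := by simpa using hA.mul hB
    have h1 := hcoef _ (hg.sub hhom) hmem
    have hAC : A = C (coeff 0 A) := by
      rw [← homogeneousComponent_zero, homogeneousComponent_eq_self hA]
    rw [hAC, coeff_sub, coeff_C_mul, sub_eq_zero] at h1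
    rw [h1] at hd
    rw [hAC]
    exact (isUnit_of_mul_isUnit_left hd).map C
  -- the evaluation
  have hlin : ∀ A B : MvPolynomial S R, A.IsHomogeneous 1 → B.IsHomogeneous 1 →
      g - A * B ∈ Ideal.span (Set.range f) → False := by
    intro A B hA hB hmem
    obtain ⟨r, hr⟩ := vr_mem hf (hg.sub (by simpa using hA.mul hB)) hmem
    have h8 : ∀ φ : S → Option (Fin 8),
        varRed φ g = X 0 * X 5 + X 4 * X 1 + X 2 * X 7 + X 6 * X 3 →
        (∀ i (v : Fin 8 → R), v 4 = 0 → v 6 = 0 → eval v (varRed φ (f i)) = 0) → False := by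
      intro φ h1 h2
      let ι : (Fin 4 → R) → (Fin 8 → R) := fun v => ![v 0, 0, v 2, 0, 0, v 1, 0, v 3]
      have hι : ∀ v w, ι (v + w) = ι v + ι w := by
        intro v w
        simp [ι]
      refine vr_quad (fun v => eval (ι v) (varRed φ A)) (fun v => eval (ι v) (varRed φ B)) ?_ ?_ ?_
      · intro v w
        simp only [hι]
        exact vr_linear φ hA _ _
      · intro v w
        simp only [hι]
        exact vr_linear φ hB _ _
      · intro v
        have h3 := congrArg (fun P => eval (ι v) (varRed φ P)) hr
        simp only [map_sub, map_mul, map_sum, h1,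
          h2 _ (ι v) (by simp [ι]) (by simp [ι]), mul_zero, Finset.sum_const_zero] at h3
        rw [sub_eq_zero] at h3
        rw [← h3]
        simp [ι]
    rcases hcase with ⟨φ, h1, h2⟩ | ⟨φ, h1, h2⟩ | ⟨φ, j, h1, h2, h3⟩
    · refine vr_quad (fun v => eval v (varRed φ A)) (fun v => eval v (varRed φ B))
        (vr_linear φ hA) (vr_linear φ hB) fun v => ?_
      have h3 := congrArg (fun P => eval v (varRed φ P)) hr
      simp only [map_sub, map_mul, map_sum, h1, h2, map_zero, mul_zero,
        Finset.sum_const_zero] at h3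
      rw [sub_eq_zero] at h3
      rw [← h3]
      simp
    · exact h8 φ h1 fun i v _ _ => by rw [h2, map_zero]
    · refine h8 φ h1 fun i v h4 h6 => ?_
      by_cases hij : i = j
      · rw [hij, h3]
        simp [h4, h6]
      · rw [h2 i hij, map_zero]
  constructor
  · intro hu
    obtain ⟨b, hb⟩ := hu.exists_right_inv
    obtain ⟨P, rfl⟩ := Ideal.Quotient.mk_surjective b
    have hmem : g * P - 1 ∈ Ideal.span (Set.range f) := by
      rw [← Ideal.Quotient.eq_zero_iff_mem, map_sub, map_mul, hb, map_one, sub_self]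
    have h1 := vrScale_ker hf hmem
    rw [map_sub, map_mul, map_one, vrScale_hom _ hg, sub_eq_zero] at h1
    have h2 := congrArg (Polynomial.eval 0) h1
    simp at h2
  · intro a b hab
    obtain ⟨i, j, A, B, hij, hA, hB, rfl, rfl⟩ := vr_factor hf hg hdom h0 a b hab
    have hmem : g - A * B ∈ Ideal.span (Set.range f) := by
      rw [← Ideal.Quotient.eq_zero_iff_mem, map_sub, map_mul, hab, sub_self]
    have : i = 0 ∧ j = 2 ∨ i = 1 ∧ j = 1 ∨ i = 2 ∧ j = 0 := by omega
    rcases this with ⟨rfl, rfl⟩ | ⟨rfl, rfl⟩ | ⟨rfl, rfl⟩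
    · exact Or.inl ((hunit A B hA hB hmem).map _)
    · exact (hlin A B hA hB hmem).elim
    · exact Or.inr ((hunit B A hB hA (by rwa [mul_comm])).map _)
end
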